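/- arXiv:math/0012073 — 2 statements merged into one kernel-verified Lean document; each statement's English description precedes it below -/
import Mathlib

section
/- Let H be a finite dimensional Hopf π-coalgebra over a field k and let α ∈ π. (a) If α has finite order d, then (S_{α⁻¹} ∘ S_α)^{2d·dim_k H_1} = id_{H_α}. (b) If α has order 2, then S_α^{8·dim_k H_1} = id_{H_α}. -/
open scoped TensorProduct

noncomputable section

/-- Transport of the algebra structure along an equality of group indices. -/
def gcast (k : Type*) [CommSemiring k] {π : Type*} (H : π → Type*)
    [∀ α, Ring (H α)] [∀ α, Algebra k (H α)] {a b : π} (h : a = b) :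
    H a ≃ₐ[k] H b := by subst h; exact AlgEquiv.refl

/-- Transport of a module family along an equality of group indices. -/
def fcast (k : Type*) [CommSemiring k] {π : Type*} (M : π → Type*)
    [∀ α, AddCommGroup (M α)] [∀ α, Module k (M α)] {a b : π} (h : a = b) :
    M a ≃ₗ[k] M b := by subst h; exact LinearEquiv.refl k (M a)

/-- A Hopf `π`-coalgebra (in the sense of Turaev/Virelizier) over a field `k`:
a family of `k`-algebras `H α` with comultiplication `Δ`, counit `ε` and antipode `S`. -/
class HopfGCoalgebra (k : Type*) [Field k] {π : Type*} [Group π]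
    (H : π → Type*) [∀ α, Ring (H α)] [∀ α, Algebra k (H α)] where
  Δ : ∀ α β : π, H (α * β) →ₐ[k] H α ⊗[k] H β
  ε : H (1 : π) →ₐ[k] k
  S : ∀ α : π, H α →ₗ[k] H α⁻¹
  coassoc : ∀ α β γ : π,
    (TensorProduct.assoc k (H α) (H β) (H γ)).toLinearMap ∘ₗ
        (TensorProduct.map (Δ α β).toLinearMap (LinearMap.id : H γ →ₗ[k] H γ)) ∘ₗ
        (Δ (α * β) γ).toLinearMap
      = (TensorProduct.map (LinearMap.id : H α →ₗ[k] H α) (Δ β γ).toLinearMap) ∘ₗ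
        (Δ α (β * γ)).toLinearMap ∘ₗ (gcast k H (mul_assoc α β γ)).toLinearMap
  counit_right : ∀ α : π,
    (TensorProduct.rid k (H α)).toLinearMap ∘ₗ
        (TensorProduct.map (LinearMap.id : H α →ₗ[k] H α) ε.toLinearMap) ∘ₗ
        (Δ α 1).toLinearMap ∘ₗ (gcast k H (mul_one α).symm).toLinearMap = LinearMap.id
  counit_left : ∀ α : π,
    (TensorProduct.lid k (H α)).toLinearMap ∘ₗ
        (TensorProduct.map ε.toLinearMap (LinearMap.id : H α →ₗ[k] H α)) ∘ₗ
        (Δ 1 α).toLinearMap ∘ₗ (gcast k H (one_mul α).symm).toLinearMap = LinearMap.id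
  antipode_left : ∀ α : π,
    (LinearMap.mul' k (H α)) ∘ₗ
        (TensorProduct.map ((gcast k H (inv_inv α)).toLinearMap ∘ₗ S α⁻¹)
          (LinearMap.id : H α →ₗ[k] H α)) ∘ₗ (Δ α⁻¹ α).toLinearMap
      = (Algebra.linearMap k (H α)) ∘ₗ ε.toLinearMap ∘ₗ
        (gcast k H (inv_mul_cancel α)).toLinearMap
  antipode_right : ∀ α : π,
    (LinearMap.mul' k (H α)) ∘ₗ
        (TensorProduct.map (LinearMap.id : H α →ₗ[k] H α)
          ((gcast k H (inv_inv α)).toLinearMap ∘ₗ S α⁻¹)) ∘ₗ (Δ α α⁻¹).toLinearMap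
      = (Algebra.linearMap k (H α)) ∘ₗ ε.toLinearMap ∘ₗ
        (gcast k H (mul_inv_cancel α)).toLinearMap

namespace HopfGCoalgebra

variable (k : Type*) [Field k] {π : Type*} [Group π] (H : π → Type*)
  [∀ α, Ring (H α)] [∀ α, Algebra k (H α)] [HopfGCoalgebra k H]

/-- A left `π`-integral for `H`. -/
def IsLeftIntegral (lam : ∀ α : π, H α →ₗ[k] k) : Prop :=
  ∀ (α β : π) (x : H (α * β)),
    (TensorProduct.rid k (H α))
        (TensorProduct.map (LinearMap.id : H α →ₗ[k] H α) (lam β) (Δ α β x))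
      = lam (α * β) x • (1 : H α)

/-- A right `π`-integral for `H`. -/
def IsRightIntegral (lam : ∀ α : π, H α →ₗ[k] k) : Prop :=
  ∀ (α β : π) (x : H (α * β)),
    (TensorProduct.lid k (H β))
        (TensorProduct.map (lam α) (LinearMap.id : H β →ₗ[k] H β) (Δ α β x))
      = lam (α * β) x • (1 : H β)

/-- A `π`-grouplike element of `H`. -/
def IsGrouplike (g : ∀ α : π, H α) : Prop :=
  (∀ α β : π, Δ α β (g (α * β)) = g α ⊗ₜ[k] g β) ∧ ε (k := k) (H := H) (g 1) = 1

/-- `g` is the distinguished `π`-grouplike element of `H`. -/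
def IsDistinguishedGrouplike (g : ∀ α : π, H α) : Prop :=
  IsGrouplike k H g ∧
    ∀ lam : ∀ α : π, H α →ₗ[k] k, IsRightIntegral k H lam →
      ∀ (α β : π) (x : H (α * β)),
        (TensorProduct.rid k (H α))
            (TensorProduct.map (LinearMap.id : H α →ₗ[k] H α) (lam β) (Δ α β x))
          = lam (α * β) x • g α

/-- `ν` is the distinguished grouplike element of `H₁*`. -/
def IsDistinguishedNu (ν : H (1 : π) →ₐ[k] k) : Prop :=
  ∀ Λ : H (1 : π), (∀ x : H (1 : π), x * Λ = ε (k := k) (H := H) x • Λ) →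
    ∀ x : H (1 : π), Λ * x = ν x • Λ

/-- The right action `a ↼ f` of `f ∈ H₁*` on `a ∈ H α`. -/
def hitR (f : H (1 : π) →ₗ[k] k) {α : π} (a : H α) : H α :=
  (TensorProduct.lid k (H α))
    (TensorProduct.map f (LinearMap.id : H α →ₗ[k] H α)
      (Δ 1 α ((gcast k H (one_mul α).symm) a)))

/-- The left action `f ⇀ a` of `f ∈ H₁*` on `a ∈ H α`. -/
def hitL (f : H (1 : π) →ₗ[k] k) {α : π} (a : H α) : H α :=
  (TensorProduct.rid k (H α))
    (TensorProduct.map (LinearMap.id : H α →ₗ[k] H α) f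
      (Δ α 1 ((gcast k H (mul_one α).symm) a)))


/-- The comultiplication, with all arguments explicit. -/
def comul (α β : π) : H (α * β) →ₐ[k] H α ⊗[k] H β := Δ α β

/-- The counit, with all arguments explicit. -/
def counit : H (1 : π) →ₐ[k] k := ε

/-- The antipode, with all arguments explicit. -/
def antipode (α : π) : H α →ₗ[k] H α⁻¹ := S α

end HopfGCoalgebra

open HopfGCoalgebra
/-- A right Hopf `π`-comodule over `H`. -/
class HopfGComodule (k : Type*) [Field k] {π : Type*} [Group π]
    (H : π → Type*) [∀ α, Ring (H α)] [∀ α, Algebra k (H α)] [HopfGCoalgebra k H]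
    (M : π → Type*) [∀ α, AddCommGroup (M α)] [∀ α, Module k (M α)] where
  ρ : ∀ α β : π, M (α * β) →ₗ[k] M α ⊗[k] H β
  ρ_coassoc : ∀ α β γ : π,
    (TensorProduct.assoc k (M α) (H β) (H γ)).toLinearMap ∘ₗ
        (TensorProduct.map (ρ α β) (LinearMap.id : H γ →ₗ[k] H γ)) ∘ₗ (ρ (α * β) γ)
      = (TensorProduct.map (LinearMap.id : M α →ₗ[k] M α) (Δ β γ).toLinearMap) ∘ₗ
        (ρ α (β * γ)) ∘ₗ (fcast k M (mul_assoc α β γ)).toLinearMap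
  ρ_counit : ∀ α : π,
    (TensorProduct.rid k (M α)).toLinearMap ∘ₗ
        (TensorProduct.map (LinearMap.id : M α →ₗ[k] M α)
          (ε (k := k) (H := H)).toLinearMap) ∘ₗ
        (ρ α 1) ∘ₗ (fcast k M (mul_one α).symm).toLinearMap = LinearMap.id
  act : ∀ α : π, M α →ₗ[k] H α →ₗ[k] M α
  act_one : ∀ (α : π) (m : M α), act α m 1 = m
  act_mul : ∀ (α : π) (m : M α) (a b : H α), act α (act α m a) b = act α m (a * b)
  ρ_act : ∀ (α β : π) (m : M (α * β)) (a : H (α * β)),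
    ρ α β (act (α * β) m a)
      = TensorProduct.map (TensorProduct.lift (act α)) (LinearMap.mul' k (H β))
          ((TensorProduct.tensorTensorTensorComm k (M α) (H β) (H α) (H β))
            (ρ α β m ⊗ₜ[k] (Δ α β a)))

namespace HopfGComodule

variable (k : Type*) [Field k] {π : Type*} [Group π] (H : π → Type*)
  [∀ α, Ring (H α)] [∀ α, Algebra k (H α)] [HopfGCoalgebra k H]
  (M : π → Type*) [∀ α, AddCommGroup (M α)] [∀ α, Module k (M α)] [HopfGComodule k H M]

/-- The submodule of coinvariant families of `H` on `M`. -/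
def coinvFam : Submodule k (∀ α, M α) where
  carrier := {m | ∀ α β : π, ρ (H := H) α β (m (α * β)) = m α ⊗ₜ[k] (1 : H β)}
  add_mem' := by
    intro a b ha hb α β
    simp only [Pi.add_apply, map_add, ha α β, hb α β, TensorProduct.add_tmul]
  zero_mem' := by
    intro α β
    simp only [Pi.zero_apply, map_zero, TensorProduct.zero_tmul]
  smul_mem' := by
    intro c a ha α β
    simp only [Pi.smul_apply, map_smul, ha α β, TensorProduct.smul_tmul']

/-- The `α`-component of the `π`-subcomodule of coinvariants. -/
def coinvSub (α : π) : Submodule k (M α) :=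
  (coinvFam k H M).map (LinearMap.proj α : (∀ γ, M γ) →ₗ[k] M α)


/-- The comodule structure maps, with all arguments explicit. -/
def coact (α β : π) : M (α * β) →ₗ[k] M α ⊗[k] H β := ρ α β

/-- The right `H α`-action on `M α`, with all arguments explicit. -/
def hact (α : π) : M α →ₗ[k] H α →ₗ[k] M α := act α

end HopfGComodule

section Cosemisimple

variable (k : Type*) [Field k] {π : Type*} [Group π] (H : π → Type*)
  [∀ α, Ring (H α)] [∀ α, Algebra k (H α)]
  (M : π → Type*) [∀ α, AddCommGroup (M α)] [∀ α, Module k (M α)]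

/-- `N` is a `π`-subcomodule of the right `π`-comodule `(M, ρ)` over `H`. -/
def IsGSubcomodule (ρ : ∀ α β : π, M (α * β) →ₗ[k] M α ⊗[k] H β)
    (N : ∀ α, Submodule k (M α)) : Prop :=
  ∀ (α β : π), ∀ x ∈ N (α * β),
    ρ α β x ∈ LinearMap.range
      (TensorProduct.map (N α).subtype (LinearMap.id : H β →ₗ[k] H β))

/-- `N` is a simple `π`-subcomodule of `(M, ρ)`. -/
def IsSimpleGSubcomodule (ρ : ∀ α β : π, M (α * β) →ₗ[k] M α ⊗[k] H β)
    (N : ∀ α, Submodule k (M α)) : Prop :=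
  IsGSubcomodule k H M ρ N ∧ (∃ α, N α ≠ ⊥) ∧
    ∀ P : ∀ α, Submodule k (M α), IsGSubcomodule k H M ρ P → (∀ α, P α ≤ N α) →
      (∀ α, P α = ⊥) ∨ P = N

/-- The right `π`-comodule `(M, ρ)` is cosemisimple: it is the sum of its simple
`π`-subcomodules. -/
def IsGCosemisimple (ρ : ∀ α β : π, M (α * β) →ₗ[k] M α ⊗[k] H β) : Prop :=
  ∀ α : π,
    (⨆ N : {N : ∀ γ, Submodule k (M γ) // IsSimpleGSubcomodule k H M ρ N}, N.1 α) = ⊤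

end Cosemisimple

section CoalgCosemisimple

variable (k : Type*) [Field k] (C : Type*) [AddCommGroup C] [Module k C]

/-- `N` is a subcomodule of the coalgebra `(C, δ)` viewed as a right comodule over itself. -/
def IsSubcoideal (δ : C →ₗ[k] C ⊗[k] C) (N : Submodule k C) : Prop :=
  ∀ x ∈ N, δ x ∈ LinearMap.range (TensorProduct.map N.subtype (LinearMap.id : C →ₗ[k] C))

def IsSimpleSubcoideal (δ : C →ₗ[k] C ⊗[k] C) (N : Submodule k C) : Prop :=
  IsSubcoideal k C δ N ∧ N ≠ ⊥ ∧
    ∀ P : Submodule k C, IsSubcoideal k C δ P → P ≤ N → P = ⊥ ∨ P = N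

/-- The coalgebra `(C, δ)` is cosemisimple. -/
def IsCosemisimpleCoalgebra (δ : C →ₗ[k] C ⊗[k] C) : Prop :=
  (⨆ N : {N : Submodule k C // IsSimpleSubcoideal k C δ N}, N.1) = ⊤

end CoalgCosemisimple
/-- A crossed Hopf `π`-coalgebra: a Hopf `π`-coalgebra with a crossing `φ`. -/
class CrossedHopfGCoalgebra (k : Type*) [Field k] {π : Type*} [Group π]
    (H : π → Type*) [∀ α, Ring (H α)] [∀ α, Algebra k (H α)]
    extends HopfGCoalgebra k H where
  φ : ∀ β α : π, H α ≃ₐ[k] H (β * α * β⁻¹)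
  φ_comul : ∀ β α γ : π,
    (TensorProduct.map (φ β α).toLinearMap (φ β γ).toLinearMap) ∘ₗ (Δ α γ).toLinearMap
      = (Δ (β * α * β⁻¹) (β * γ * β⁻¹)).toLinearMap ∘ₗ
        (gcast k H (show β * (α * γ) * β⁻¹ = (β * α * β⁻¹) * (β * γ * β⁻¹) by
          group)).toLinearMap ∘ₗ (φ β (α * γ)).toLinearMap
  φ_counit : ∀ (β : π) (x : H (1 : π)),
    ε ((gcast k H (show β * 1 * β⁻¹ = (1 : π) by group)) (φ β 1 x)) = ε x
  φ_mul : ∀ (β β' α : π) (x : H α),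
    (gcast k H (show β * (β' * α * β'⁻¹) * β⁻¹ = (β * β') * α * (β * β')⁻¹ by group))
        (φ β (β' * α * β'⁻¹) (φ β' α x))
      = φ (β * β') α x


namespace CrossedHopfGCoalgebra

variable (k : Type*) [Field k] {π : Type*} [Group π] (H : π → Type*)
  [∀ α, Ring (H α)] [∀ α, Algebra k (H α)] [CrossedHopfGCoalgebra k H]

/-- The crossing, with all arguments explicit. -/
def crossing (β α : π) : H α ≃ₐ[k] H (β * α * β⁻¹) := φ β α

end CrossedHopfGCoalgebra

open CrossedHopfGCoalgebra

/-- A quasitriangular Hopf `π`-coalgebra: a crossed Hopf `π`-coalgebra with an R-matrix. -/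
class QTHopfGCoalgebra (k : Type*) [Field k] {π : Type*} [Group π]
    (H : π → Type*) [∀ α, Ring (H α)] [∀ α, Algebra k (H α)]
    extends CrossedHopfGCoalgebra k H where
  Rm : ∀ α β : π, H α ⊗[k] H β
  Rm_isUnit : ∀ α β : π, IsUnit (Rm α β)
  Rm_comul : ∀ (α β : π) (x : H (α * β)),
    Rm α β * Δ α β x
      = (TensorProduct.comm k (H β) (H α))
          ((TensorProduct.map
              ((gcast k H (show α⁻¹ * (α * β * α⁻¹) * α⁻¹⁻¹ = β by group)).toLinearMap ∘ₗ
                (φ α⁻¹ (α * β * α⁻¹)).toLinearMap)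
              (LinearMap.id : H α →ₗ[k] H α))
            ((Δ (α * β * α⁻¹) α)
              ((gcast k H (show α * β = (α * β * α⁻¹) * α by group)) x))) * Rm α β
  Rm_delta_right : ∀ α β γ : π,
    TensorProduct.map (LinearMap.id : H α →ₗ[k] H α) (Δ β γ).toLinearMap (Rm α (β * γ))
      = (TensorProduct.map (LinearMap.id : H α →ₗ[k] H α)
            (TensorProduct.mk k (H β) (H γ) 1) (Rm α γ))
        * (TensorProduct.map (LinearMap.id : H α →ₗ[k] H α)
            ((TensorProduct.mk k (H β) (H γ)).flip 1) (Rm α β))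
  Rm_delta_left : ∀ α β γ : π,
    (TensorProduct.assoc k (H α) (H β) (H γ))
        (TensorProduct.map (Δ α β).toLinearMap (LinearMap.id : H γ →ₗ[k] H γ)
          (Rm (α * β) γ))
      = (TensorProduct.map (LinearMap.id : H α →ₗ[k] H α)
            (TensorProduct.mk k (H β) (H γ) 1)
            (TensorProduct.map (LinearMap.id : H α →ₗ[k] H α)
              ((gcast k H (show β⁻¹ * (β * γ * β⁻¹) * β⁻¹⁻¹ = γ by group)).toLinearMap ∘ₗ
                (φ β⁻¹ (β * γ * β⁻¹)).toLinearMap)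
              (Rm α (β * γ * β⁻¹))))
        * (TensorProduct.mk k (H α) (H β ⊗[k] H γ) 1 (Rm β γ))
  Rm_phi : ∀ β α γ : π,
    TensorProduct.map (φ β α).toLinearMap (φ β γ).toLinearMap (Rm α γ)
      = Rm (β * α * β⁻¹) (β * γ * β⁻¹)

namespace QTHopfGCoalgebra

variable (k : Type*) [Field k] {π : Type*} [Group π] (H : π → Type*)
  [∀ α, Ring (H α)] [∀ α, Algebra k (H α)] [QTHopfGCoalgebra k H]

/-- The square of the antipode `S_{α⁻¹} ∘ S_α : H α → H α`. -/
def antipodeSq (α : π) : H α →ₗ[k] H α :=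
  (gcast k H (inv_inv α)).toLinearMap ∘ₗ S α⁻¹ ∘ₗ S α

/-- The map `S_{α⁻¹} ∘ φ_α : H (α⁻¹) → H α`. -/
def sphi (α : π) : H α⁻¹ →ₗ[k] H α :=
  (gcast k H (inv_inv α)).toLinearMap ∘ₗ S α⁻¹ ∘ₗ
    (gcast k H (show α * α⁻¹ * α⁻¹ = α⁻¹ by group)).toLinearMap ∘ₗ
    (φ α α⁻¹).toLinearMap

/-- The Drinfeld element `u_α = m_α ∘ (S_{α⁻¹}φ_α ⊗ id) ∘ σ_{α,α⁻¹} (R_{α,α⁻¹})`. -/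
def drinfeld (α : π) : H α :=
  LinearMap.mul' k (H α)
    (TensorProduct.map (sphi k H α) (LinearMap.id : H α →ₗ[k] H α)
      ((TensorProduct.comm k (H α) (H α⁻¹)) (Rm α α⁻¹)))

/-- The element `S_{α⁻¹}(u_{α⁻¹}) ∈ H α`. -/
def sdrinfeld (α : π) : H α :=
  (gcast k H (inv_inv α)) (S (k := k) (H := H) α⁻¹ (drinfeld k H α⁻¹))

/-- The `π`-grouplike element `ℓ_α = S_{α⁻¹}(u_{α⁻¹})⁻¹ u_α`. -/
def ell (α : π) : H α :=
  Ring.inverse (sdrinfeld k H α) * drinfeld k H α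


/-- The R-matrix, with all arguments explicit. -/
def rmatrix (α β : π) : H α ⊗[k] H β := Rm α β

end QTHopfGCoalgebra

open QTHopfGCoalgebra

namespace RepRank

section Rank

variable {k G : Type*} [Field k] [Group G]
variable {X X' Y Z : Type*} [AddCommMonoid X] [Module k X] [AddCommMonoid X'] [Module k X']
  [AddCommGroup Y] [Module k Y]
  [AddCommGroup Z] [Module k Z]

/-- The rank of the operator by which an element of the group algebra acts. -/
def rk (σ : Representation k G X) (f : MonoidAlgebra k G) : ℕ :=
  Module.finrank k (LinearMap.range (σ.asAlgebraHom f))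

lemma asAlgebraHom_intertwine {σ : Representation k G X} {τ : Representation k G X'}
    {i : X →ₗ[k] X'} (h : ∀ g x, i (σ g x) = τ g (i x)) (f : MonoidAlgebra k G) (x : X) :
    i (σ.asAlgebraHom f x) = τ.asAlgebraHom f (i x) := by
  induction f using MonoidAlgebra.induction_on with
  | of g => simp [h]
  | add a b ha hb => simp only [map_add, LinearMap.add_apply, ha, hb]
  | smul r a ha => simp only [map_smul, LinearMap.smul_apply, ha]

lemma rk_eq_of_equiv {σ : Representation k G X} {τ : Representation k G X'}
    (e : X ≃ₗ[k] X') (h : ∀ g x, e (σ g x) = τ g (e x)) (f : MonoidAlgebra k G) :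
    rk σ f = rk τ f := by
  have h1 : ∀ x, e (σ.asAlgebraHom f x) = τ.asAlgebraHom f (e x) :=
    asAlgebraHom_intertwine (i := e.toLinearMap) h f
  have h2 : LinearMap.range (τ.asAlgebraHom f) =
      (LinearMap.range (σ.asAlgebraHom f)).map e.toLinearMap := by
    ext y
    constructor
    · rintro ⟨z, rfl⟩
      exact ⟨_, ⟨e.symm z, rfl⟩, by simp [h1]⟩
    · rintro ⟨_, ⟨z, rfl⟩, rfl⟩
      exact ⟨e z, by simp [h1]⟩
  rw [rk, rk, h2]
  exact (LinearEquiv.finrank_map_eq e _).symm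

lemma rk_add_rk_le [FiniteDimensional k Y] {σ : Representation k G X} {τ : Representation k G Y}
    {υ : Representation k G Z} {i : X →ₗ[k] Y} {q : Y →ₗ[k] Z}
    (hi : ∀ g x, i (σ g x) = τ g (i x)) (hq : ∀ g y, q (τ g y) = υ g (q y))
    (hinj : Function.Injective i) (hsurj : Function.Surjective q) (hqi : ∀ x, q (i x) = 0)
    (f : MonoidAlgebra k G) : rk σ f + rk υ f ≤ rk τ f := by
  have hi' := asAlgebraHom_intertwine hi f
  have hq' := asAlgebraHom_intertwine hq f
  let R := LinearMap.range (τ.asAlgebraHom f)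
  have h1 : LinearMap.range (q.domRestrict R) = LinearMap.range (υ.asAlgebraHom f) := by
    ext z
    constructor
    · rintro ⟨⟨_, y, rfl⟩, rfl⟩
      exact ⟨q y, (hq' y).symm⟩
    · rintro ⟨z, rfl⟩
      obtain ⟨y, rfl⟩ := hsurj z
      exact ⟨⟨_, y, rfl⟩, hq' y⟩
  have h2 : ∀ x : LinearMap.range (σ.asAlgebraHom f), i x ∈ R := by
    rintro ⟨_, x, rfl⟩
    exact ⟨i x, (hi' x).symm⟩
  let j : LinearMap.range (σ.asAlgebraHom f) →ₗ[k] LinearMap.ker (q.domRestrict R) :=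
    LinearMap.codRestrict _ (LinearMap.codRestrict R (i.domRestrict _) h2) fun x => hqi x
  have hj : Function.Injective j := by
    intro a b hab
    have : i a = i b := congrArg (fun z : LinearMap.ker (q.domRestrict R) => ((z : R) : Y)) hab
    exact Subtype.ext (hinj this)
  have h3 := LinearMap.finrank_range_add_finrank_ker (q.domRestrict R)
  have h4 := LinearMap.finrank_le_finrank_of_injective hj
  rw [h1] at h3
  change Module.finrank k _ + Module.finrank k _ ≤ Module.finrank k R
  omega

lemma finrank_range_lTensor (F : Module.End k Z) :
    Module.finrank k (LinearMap.range (F.lTensor Y)) =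
      Module.finrank k Y * Module.finrank k (LinearMap.range F) := by
  have h1 : F.lTensor Y = (LinearMap.range F).subtype.lTensor Y ∘ₗ F.rangeRestrict.lTensor Y := by
    rw [← LinearMap.lTensor_comp]; rfl
  have h2 : Function.Surjective (F.rangeRestrict.lTensor Y) :=
    LinearMap.lTensor_surjective Y F.surjective_rangeRestrict
  have h3 : Function.Injective ((LinearMap.range F).subtype.lTensor Y) :=
    Module.Flat.lTensor_preserves_injective_linearMap _ (Submodule.injective_subtype _)
  rw [h1, LinearMap.range_comp_of_range_eq_top _ (LinearMap.range_eq_top.mpr h2),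
    LinearMap.finrank_range_of_inj h3, Module.finrank_tensorProduct]

lemma rk_trivial_tprod (σ : Representation k G Z) (f : MonoidAlgebra k G) :
    rk ((Representation.trivial k G Y).tprod σ) f = Module.finrank k Y * rk σ f := by
  have : ((Representation.trivial k G Y).tprod σ).asAlgebraHom f =
      (σ.asAlgebraHom f).lTensor Y := by
    apply TensorProduct.ext'
    intro y x
    induction f using MonoidAlgebra.induction_on with
    | of g => simp
    | add a b ha hb =>
      simp only [map_add, LinearMap.add_apply, ha, hb, LinearMap.lTensor_add]
    | smul r a ha => simp only [map_smul, LinearMap.smul_apply, ha, LinearMap.lTensor_smul]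
  rw [rk, this, finrank_range_lTensor]
  rfl

variable (k G) in
/-- The left regular representation on finitely supported functions. -/
def regular : Representation k G (G →₀ k) where
  toFun g := Finsupp.lmapDomain k k (g * ·)
  map_one' := by ext; simp
  map_mul' g h := by ext; simp [mul_assoc]

@[simp] lemma regular_single (g h : G) (r : k) :
    regular k G g (Finsupp.single h r) = Finsupp.single (g * h) r := by
  simp [regular]

/-- `g ⊗ x ↦ g ⊗ σ g x`. -/
def untwistMap {ι : Type*} (σ : ι → Module.End k X) : (ι →₀ k) ⊗[k] X →ₗ[k] (ι →₀ k) ⊗[k] X :=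
  TensorProduct.lift (Finsupp.linearCombination k fun g =>
    TensorProduct.mk k (ι →₀ k) X (Finsupp.single g 1) ∘ₗ σ g)

@[simp] lemma untwistMap_tmul {ι : Type*} (σ : ι → Module.End k X) (g : ι) (x : X) :
    untwistMap σ (Finsupp.single g 1 ⊗ₜ x) = Finsupp.single g 1 ⊗ₜ σ g x := by
  simp [untwistMap]

/-- The regular representation absorbs every representation. -/
def untwist (σ : Representation k G X) : (G →₀ k) ⊗[k] X ≃ₗ[k] (G →₀ k) ⊗[k] X :=
  LinearEquiv.ofLinearMap (untwistMap fun g => σ g) (untwistMap fun g => σ g⁻¹)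
    (by ext; simp) (by ext; simp)

lemma rk_regular_tprod (σ : Representation k G Y) (f : MonoidAlgebra k G) :
    rk ((regular k G).tprod σ) f = Module.finrank k Y * rk (regular k G) f := by
  refine Eq.trans ?_ (rk_trivial_tprod (Y := Y) (regular k G) f)
  symm
  refine rk_eq_of_equiv (TensorProduct.comm k Y (G →₀ k) ≪≫ₗ untwist σ) ?_ f
  intro g t
  have : ((TensorProduct.comm k Y (G →₀ k) ≪≫ₗ untwist σ).toLinearMap ∘ₗ
      ((Representation.trivial k G Y).tprod (regular k G)) g) =
      ((regular k G).tprod σ) g ∘ₗ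
        (TensorProduct.comm k Y (G →₀ k) ≪≫ₗ untwist σ).toLinearMap := by
    ext; simp [untwist]
  exact LinearMap.congr_fun this t

end Rank

section Divisibility

universe u v w
variable {k : Type u} {G : Type v} {V : Type w} [Field k] [Group G]
  [AddCommGroup V] [Module k V] [FiniteDimensional k V]

/-- One step of the estimate: `ρ` contains the regular representation, with quotient `ω`. -/
lemma rk_step {W X : Type*} [AddCommGroup W] [Module k W] [AddCommGroup X] [Module k X]
    [FiniteDimensional k X]
    {ρ : Representation k G V} {ω : Representation k G W} {i : (G →₀ k) →ₗ[k] V} {q : V →ₗ[k] W}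
    (hi : ∀ g x, i (regular k G g x) = ρ g (i x)) (hq : ∀ g y, q (ρ g y) = ω g (q y))
    (hinj : Function.Injective i) (hsurj : Function.Surjective q) (hqi : ∀ x, q (i x) = 0)
    (E : V ⊗[k] V ≃ₗ[k] V ⊗[k] V)
    (hE : ∀ g t, E (ρ.tprod ρ g t) = (Representation.trivial k G V).tprod ρ g (E t))
    (σ : Representation k G X) (f : MonoidAlgebra k G) :
    Module.finrank k V * Module.finrank k X * rk (regular k G) f + rk (ρ.tprod (ω.tprod σ)) f ≤
      Module.finrank k V * rk (ρ.tprod σ) f := by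
  have h1 : rk (ρ.tprod (ρ.tprod σ)) f = Module.finrank k V * rk (ρ.tprod σ) f := by
    rw [← rk_trivial_tprod]
    refine rk_eq_of_equiv ((TensorProduct.assoc k V V X).symm ≪≫ₗ
      TensorProduct.congr E (LinearEquiv.refl k X) ≪≫ₗ TensorProduct.assoc k V V X) ?_ f
    intro g t
    have hE' : E.toLinearMap ∘ₗ ρ.tprod ρ g =
        (Representation.trivial k G V).tprod ρ g ∘ₗ E.toLinearMap := by
      ext1; exact LinearMap.ext fun _ => LinearMap.ext fun _ => hE g _
    induction t using TensorProduct.induction_on with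
    | zero => simp
    | add a b ha hb => simp only [map_add, ha, hb]
    | tmul a s =>
      induction s using TensorProduct.induction_on with
      | zero => simp
      | add c d hc hd => simp only [TensorProduct.tmul_add, map_add, hc, hd]
      | tmul b x =>
        have h2 := hE g (a ⊗ₜ b)
        simp only [Representation.tprod_apply, TensorProduct.map_tmul] at h2
        simp only [Representation.tprod_apply, TensorProduct.map_tmul, LinearEquiv.trans_apply,
          TensorProduct.assoc_symm_tmul, TensorProduct.congr_tmul, LinearEquiv.refl_apply, h2]
        induction E (a ⊗ₜ b) using TensorProduct.induction_on with
        | zero => simp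
        | add c d hc hd => simp only [TensorProduct.add_tmul, map_add, hc, hd]
        | tmul c d => simp
  have h2 : rk (ρ.tprod (ω.tprod σ)) f = rk (ω.tprod (ρ.tprod σ)) f := by
    refine rk_eq_of_equiv (TensorProduct.leftComm k V W X) ?_ f
    intro g t
    have : (TensorProduct.leftComm k V W X).toLinearMap ∘ₗ ρ.tprod (ω.tprod σ) g =
        ω.tprod (ρ.tprod σ) g ∘ₗ (TensorProduct.leftComm k V W X).toLinearMap := by
      ext; simp
    exact LinearMap.congr_fun this t
  have h3 : rk ((regular k G).tprod (ρ.tprod σ)) f + rk (ω.tprod (ρ.tprod σ)) f ≤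
      rk (ρ.tprod (ρ.tprod σ)) f := by
    refine rk_add_rk_le (i := i.rTensor _) (q := q.rTensor _) ?_ ?_
      (Module.Flat.rTensor_preserves_injective_linearMap i hinj)
      (LinearMap.rTensor_surjective _ hsurj) ?_ f
    · intro g t
      induction t using TensorProduct.induction_on with
      | zero => simp
      | add a b ha hb => simp only [map_add, ha, hb]
      | tmul a b => simp only [Representation.tprod_apply, TensorProduct.map_tmul,
          LinearMap.rTensor_tmul, hi]
    · intro g t
      induction t using TensorProduct.induction_on with
      | zero => simp
      | add a b ha hb => simp only [map_add, ha, hb]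
      | tmul a b => simp only [Representation.tprod_apply, TensorProduct.map_tmul,
          LinearMap.rTensor_tmul, hq]
    · intro t
      have : q ∘ₗ i = 0 := LinearMap.ext hqi
      rw [← LinearMap.rTensor_comp_apply, this]
      simp
  rw [rk_regular_tprod, Module.finrank_tensorProduct, h1, ← h2] at h3
  exact h3

lemma rk_iterate {W : Type w} [AddCommGroup W] [Module k W] [FiniteDimensional k W]
    {ρ : Representation k G V} {ω : Representation k G W} {i : (G →₀ k) →ₗ[k] V} {q : V →ₗ[k] W}
    (hi : ∀ g x, i (regular k G g x) = ρ g (i x)) (hq : ∀ g y, q (ρ g y) = ω g (q y))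
    (hinj : Function.Injective i) (hsurj : Function.Surjective q) (hqi : ∀ x, q (i x) = 0)
    (hdim : Module.finrank k V = Nat.card G + Module.finrank k W)
    (E : V ⊗[k] V ≃ₗ[k] V ⊗[k] V)
    (hE : ∀ g t, E (ρ.tprod ρ g t) = (Representation.trivial k G V).tprod ρ g (E t))
    (f : MonoidAlgebra k G) (N : ℕ) :
    ∀ (X : Type w) [AddCommGroup X] [Module k X] [FiniteDimensional k X]
      (σ : Representation k G X),
      Module.finrank k V ^ N * (rk (regular k G) f * Module.finrank k X * Module.finrank k V) ≤
        Module.finrank k V ^ N * (Nat.card G * rk (ρ.tprod σ) f) +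
          Module.finrank k W ^ N * (rk (regular k G) f * Module.finrank k V * Module.finrank k X)
      := by
  induction N with
  | zero => intro X _ _ _ σ; simp only [pow_zero, one_mul]; nlinarith
  | succ N ih =>
    intro X _ _ _ σ
    have h1 := rk_step hi hq hinj hsurj hqi E hE σ f
    have h2 := ih (W ⊗[k] X) (ω.tprod σ)
    rw [Module.finrank_tensorProduct] at h2
    have h3 := Nat.mul_le_mul_left (Module.finrank k V ^ N * Nat.card G) h1
    generalize rk (ρ.tprod (ω.tprod σ)) f = a at *
    generalize rk (ρ.tprod σ) f = b at *
    generalize rk (regular k G) f = r at *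
    generalize Module.finrank k X = x at *
    generalize Module.finrank k W = w at *
    generalize Module.finrank k V = m at *
    generalize Nat.card G = n at *
    subst hdim
    rw [pow_succ, pow_succ]
    generalize (n + w) ^ N = P at *
    generalize w ^ N = Q at *
    nlinarith

/-- A representation `ρ` of a finite group that contains the regular one and satisfies
`ρ ⊗ ρ ≅ 1 ⊗ ρ` has at least the rank density of the regular representation. -/
lemma rk_regular_le [Finite G] {ρ : Representation k G V} {v : V}
    (hv : LinearIndependent k fun g => ρ g v)
    (E : V ⊗[k] V ≃ₗ[k] V ⊗[k] V)
    (hE : ∀ g t, E (ρ.tprod ρ g t) = (Representation.trivial k G V).tprod ρ g (E t))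
    (f : MonoidAlgebra k G) :
    rk (regular k G) f * Module.finrank k V ≤ Nat.card G * rk ρ f := by
  let i : (G →₀ k) →ₗ[k] V := Finsupp.linearCombination k fun g => ρ g v
  have hi : ∀ g x, i (regular k G g x) = ρ g (i x) := by
    intro g x
    have : i ∘ₗ regular k G g = ρ g ∘ₗ i := by ext h; simp [i]
    exact LinearMap.congr_fun this x
  let W := LinearMap.range i
  have hW : ∀ g, W ≤ W.comap (ρ g) := by
    rintro g _ ⟨x, rfl⟩
    exact ⟨_, hi g x⟩
  let ω := ρ.quotient W hW
  have hdim : Module.finrank k V = Nat.card G + Module.finrank k (V ⧸ W) := by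
    have h1 := Submodule.finrank_quotient_add_finrank W
    have := Fintype.ofFinite G
    rw [LinearMap.finrank_range_of_inj hv, Module.finrank_finsupp_self,
      ← Nat.card_eq_fintype_card] at h1
    omega
  have key := fun N => rk_iterate hi (ω := ω) (q := W.mkQ) (fun g y => rfl) hv
    (Submodule.mkQ_surjective W) (fun x => by simp [W]) hdim E hE f N V
    (Representation.trivial k G V)
  have h1 : rk (ρ.tprod (Representation.trivial k G V)) f = Module.finrank k V * rk ρ f := by
    rw [← rk_trivial_tprod]
    refine rk_eq_of_equiv (TensorProduct.comm k V V) ?_ f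
    intro g t
    have : (TensorProduct.comm k V V).toLinearMap ∘ₗ ρ.tprod (Representation.trivial k G V) g =
        (Representation.trivial k G V).tprod ρ g ∘ₗ (TensorProduct.comm k V V).toLinearMap := by
      ext; simp
    exact LinearMap.congr_fun this t
  rw [h1] at key
  have hn : 0 < Nat.card G := Nat.card_pos
  by_contra! hlt
  generalize Module.finrank k (V ⧸ W) = w at *
  generalize Module.finrank k V = m at *
  generalize rk (regular k G) f = r at *
  generalize rk ρ f = a at *
  have hm : 0 < m := by omega
  -- `m ^ N ≤ C * w ^ N` for all `N` contradicts `w < m`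
  have h2 : ∀ N : ℕ, (m : ℝ) ^ N * 1 ≤ (w : ℝ) ^ N * (r * m) := by
    intro N
    have h3 : m ^ N * (Nat.card G * a + 1) ≤ m ^ N * (r * m) := Nat.mul_le_mul_left _ hlt
    have h4 := key N
    have h5 : m * (m ^ N * 1) ≤ m * (w ^ N * (r * m)) := by nlinarith
    exact_mod_cast Nat.le_of_mul_le_mul_left h5 hm
  have hm' : (0 : ℝ) < m := by exact_mod_cast hm
  have h3 : ∀ N : ℕ, (1 : ℝ) ≤ ((w : ℝ) / m) ^ N * (r * m) := by
    intro N
    rw [div_pow, div_mul_eq_mul_div, le_div_iff₀ (by positivity)]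
    linarith [h2 N]
  have h4 : Filter.Tendsto (fun N : ℕ => ((w : ℝ) / m) ^ N * (r * m)) Filter.atTop
      (nhds (0 * (r * m))) := by
    refine (tendsto_pow_atTop_nhds_zero_of_lt_one (by positivity) ?_).mul_const _
    rw [div_lt_one hm']
    exact_mod_cast (by omega : w < m)
  have h5 := ge_of_tendsto' h4 h3
  norm_num at h5

end Divisibility

section Cyclic

variable {k G V : Type*} [Field k] [Group G] [AddCommGroup V] [Module k V]
  [FiniteDimensional k V]

lemma rk_add_rk_le_finrank (ρ : Representation k G V) {f f' : MonoidAlgebra k G}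
    (h : f * f' = 0) : rk ρ f + rk ρ f' ≤ Module.finrank k V := by
  have h1 := LinearMap.finrank_range_add_finrank_ker (ρ.asAlgebraHom f)
  have h2 : LinearMap.range (ρ.asAlgebraHom f') ≤ LinearMap.ker (ρ.asAlgebraHom f) := by
    rintro _ ⟨x, rfl⟩
    rw [LinearMap.mem_ker, ← Module.End.mul_apply, ← map_mul, h]
    simp
  have h3 := Submodule.finrank_mono h2
  change Module.finrank k _ + Module.finrank k _ ≤ _
  omega

variable [Finite G]

lemma exists_norm_element {g₀ : G} (hg₀ : ∀ g, g ∈ Subgroup.zpowers g₀) :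
    ∃ f : MonoidAlgebra k G, (MonoidAlgebra.of k G g₀ - 1) * f = 0 ∧ 1 ≤ rk (regular k G) f ∧
      Nat.card G ≤ rk (regular k G) (MonoidAlgebra.of k G g₀ - 1) + 1 := by
  have := Fintype.ofFinite G
  refine ⟨∑ g : G, MonoidAlgebra.of k G g, ?_, ?_, ?_⟩
  · rw [sub_mul, Finset.mul_sum, one_mul, sub_eq_zero]
    refine Fintype.sum_equiv (Equiv.mulLeft g₀) _ _ fun g => ?_
    simp
  · rw [rk, Nat.one_le_iff_ne_zero, Ne, Submodule.finrank_eq_zero, LinearMap.range_eq_bot]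
    intro h0
    have h1 := LinearMap.congr_fun h0 (Finsupp.single 1 1)
    have h2 := DFunLike.congr_fun h1 1
    simp [LinearMap.sum_apply, Finsupp.finsetSum_apply] at h2
  · have h1 := LinearMap.finrank_range_add_finrank_ker
      ((regular k G).asAlgebraHom (MonoidAlgebra.of k G g₀ - 1))
    rw [Module.finrank_finsupp_self, ← Nat.card_eq_fintype_card] at h1
    have h2 : Module.finrank k (LinearMap.ker
        ((regular k G).asAlgebraHom (MonoidAlgebra.of k G g₀ - 1))) ≤ 1 := by
      have hinj : Function.Injective ((Finsupp.lapply (1 : G)).domRestrict (LinearMap.ker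
          ((regular k G).asAlgebraHom (MonoidAlgebra.of k G g₀ - 1))) : _ →ₗ[k] k) := by
        rw [injective_iff_map_eq_zero]
        rintro ⟨x, hx⟩ hx0
        have hx1 : regular k G g₀ x = x := by
          simpa [sub_eq_zero] using hx
        have hstep : ∀ g, x (g₀ * g) = x g := by
          intro g
          conv_lhs => rw [← hx1]
          exact Finsupp.mapDomain_apply (mul_right_injective g₀) x g
        have hz : ∀ n : ℤ, x (g₀ ^ n) = x 1 := by
          intro n
          induction n with
          | zero => simp
          | succ n ih => rw [add_comm, zpow_add, zpow_one, hstep, ih]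
          | pred n ih => rw [← ih, ← hstep, ← zpow_one_add]; congr 2; ring
        ext g
        obtain ⟨n, rfl⟩ := hg₀ g
        exact (hz n).trans hx0
      simpa using LinearMap.finrank_le_finrank_of_injective hinj
    change _ ≤ Module.finrank k _ + 1
    omega

/-- If a representation of a cyclic group contains the regular one and satisfies
`ρ ⊗ ρ ≅ 1 ⊗ ρ`, the order of the group divides the dimension. -/
lemma card_dvd_finrank {g₀ : G} (hg₀ : ∀ g, g ∈ Subgroup.zpowers g₀)
    {ρ : Representation k G V} {v : V} (hv : LinearIndependent k fun g => ρ g v)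
    (E : V ⊗[k] V ≃ₗ[k] V ⊗[k] V)
    (hE : ∀ g t, E (ρ.tprod ρ g t) = (Representation.trivial k G V).tprod ρ g (E t)) :
    Nat.card G ∣ Module.finrank k V := by
  obtain ⟨f, hf, h1, h2⟩ := exists_norm_element (k := k) hg₀
  have h3 := rk_regular_le hv E hE f
  have h4 := rk_regular_le hv E hE (MonoidAlgebra.of k G g₀ - 1)
  have h5 := rk_add_rk_le_finrank ρ hf
  refine ⟨rk ρ f, ?_⟩
  have h6 := Nat.mul_le_mul_left (Nat.card G) h5
  have h7 := Nat.mul_le_mul_right (Module.finrank k V) h1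
  have h8 := Nat.mul_le_mul_right (Module.finrank k V) h2
  nlinarith

end Cyclic

/-- An operator `u` with `u ⊗ u` conjugate to `1 ⊗ u` and an independent orbit has order dividing
the dimension. -/
theorem pow_finrank_eq_one {k Γ V : Type*} [Field k] [Group Γ] [AddCommGroup V] [Module k V]
    [FiniteDimensional k V] (ρ : Representation k Γ V) (u : Γ) {v : V}
    (hv : LinearIndependent k fun g : Subgroup.zpowers u => ρ g v)
    (E : V ⊗[k] V ≃ₗ[k] V ⊗[k] V)
    (hE : ∀ g a b, E (ρ g a ⊗ₜ ρ g b) = (ρ g).lTensor V (E (a ⊗ₜ b))) :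
    u ^ Module.finrank k V = 1 := by
  have : Finite (Subgroup.zpowers u) := hv.finite
  rw [← orderOf_dvd_iff_pow_eq_one, ← Nat.card_zpowers]
  refine card_dvd_finrank (G := Subgroup.zpowers u) (g₀ := ⟨u, Subgroup.mem_zpowers u⟩)
    (fun ⟨_, n, hn⟩ => ⟨n, Subtype.ext (by simpa using hn)⟩)
    (ρ := ρ.comp (Subgroup.zpowers u).subtype) hv E ?_
  intro g t
  induction t using TensorProduct.induction_on with
  | zero => simp
  | add a b ha hb => simp only [map_add, ha, hb]
  | tmul a b => exact hE g a b

end RepRank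

namespace FinHopf
open WithConv

variable {k : Type*} {K : Type*} [Field k] [Ring K] [HopfAlgebra k K]

local notation "inc₁" => (Algebra.TensorProduct.includeLeft : K →ₐ[k] K ⊗[k] K)
local notation "inc₂" => (Algebra.TensorProduct.includeRight : K →ₐ[k] K ⊗[k] K)
local notation "anti" => (HopfAlgebra.antipode k (A := K))
local notation "cop" => (Coalgebra.comul (R := k) (A := K))

lemma algHom_antipode_conv_self {A : Type*} [Ring A] [Algebra k A] (f : K →ₐ[k] A) :
    toConv (f.toLinearMap ∘ₗ anti) * toConv f.toLinearMap = 1 := by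
  have h := LinearMap.algHom_comp_convMul_distrib f (toConv anti) (toConv LinearMap.id)
  rw [LinearMap.antipode_mul_id] at h
  apply WithConv.ofConv_injective
  refine Eq.trans h.symm ?_
  ext x; simp

lemma algHom_self_conv_antipode {A : Type*} [Ring A] [Algebra k A] (f : K →ₐ[k] A) :
    toConv f.toLinearMap * toConv (f.toLinearMap ∘ₗ anti) = 1 := by
  have h := LinearMap.algHom_comp_convMul_distrib f (toConv LinearMap.id) (toConv anti)
  rw [LinearMap.id_mul_antipode] at h
  apply WithConv.ofConv_injective
  refine Eq.trans h.symm ?_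
  ext x; simp

lemma includeLeft_conv_includeRight :
    toConv (inc₁).toLinearMap * toConv (inc₂).toLinearMap = toConv cop := by
  apply WithConv.ofConv_injective
  ext x
  have : LinearMap.mul' k (K ⊗[k] K) ∘ₗ TensorProduct.map (inc₁).toLinearMap (inc₂).toLinearMap
    = LinearMap.id := by ext; simp
  exact LinearMap.congr_fun this (cop x)

lemma comul_antipode_conv : toConv (cop ∘ₗ anti) =
    toConv ((inc₂).toLinearMap ∘ₗ anti) * toConv ((inc₁).toLinearMap ∘ₗ anti) := by
  symm
  refine left_inv_eq_right_inv (a := toConv cop) ?_ LinearMap.comul_right_inv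
  rw [← includeLeft_conv_includeRight, mul_assoc, ← mul_assoc _ (toConv (inc₁).toLinearMap),
    algHom_antipode_conv_self, one_mul, algHom_antipode_conv_self]

lemma comul_antipode (x : K) :
    cop (anti x) = TensorProduct.map anti anti (TensorProduct.comm k K K (cop x)) := by
  have := LinearMap.congr_fun (congrArg ofConv (comul_antipode_conv (k := k))) x
  refine this.trans ?_
  have h2 : LinearMap.mul' k (K ⊗[k] K) ∘ₗ TensorProduct.map ((inc₂).toLinearMap ∘ₗ anti)
      ((inc₁).toLinearMap ∘ₗ anti)
    = TensorProduct.map anti anti ∘ₗ (TensorProduct.comm k K K).toLinearMap := by ext; simp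
  exact LinearMap.congr_fun h2 (cop x)

/-- `x ↦ f x₁ • x₂`, on an arbitrary tensor. -/
def evalLeft (f : K →ₗ[k] k) : K ⊗[k] K →ₗ[k] K :=
  (TensorProduct.lid k K).toLinearMap ∘ₗ f.rTensor K

def evalRight (f : K →ₗ[k] k) : K ⊗[k] K →ₗ[k] K :=
  (TensorProduct.rid k K).toLinearMap ∘ₗ f.lTensor K

@[simp] lemma evalLeft_tmul (f : K →ₗ[k] k) (x y : K) : evalLeft f (x ⊗ₜ y) = f x • y := by
  simp [evalLeft]

@[simp] lemma evalRight_tmul (f : K →ₗ[k] k) (x y : K) : evalRight f (x ⊗ₜ y) = f y • x := by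
  simp [evalRight]

/-- `x ↦ f x₁ • x₂` -/
def actL (f : K →ₗ[k] k) : Module.End k K := evalLeft f ∘ₗ Coalgebra.comul

def actR (f : K →ₗ[k] k) : Module.End k K := evalRight f ∘ₗ Coalgebra.comul

lemma comul_actL (f : K →ₗ[k] k) (x : K) :
    cop (actL f x) = (actL f).rTensor K (cop x) := by
  have h1 : cop ∘ₗ evalLeft f = (evalLeft f).rTensor K ∘ₗ
      (TensorProduct.assoc k K K K).symm.toLinearMap ∘ₗ (cop).lTensor K := by
    apply TensorProduct.ext'
    intro a b
    simp only [LinearMap.comp_apply, evalLeft_tmul, map_smul, LinearMap.lTensor_tmul]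
    induction cop b using TensorProduct.induction_on with
    | zero => simp
    | add u v hu hv => rw [smul_add, hu, hv, TensorProduct.tmul_add, map_add, map_add]
    | tmul u v => simp [TensorProduct.smul_tmul']
  have h2 := congrArg ((evalLeft f).rTensor K) (Coalgebra.coassoc_symm_apply (R := k) x)
  have h3 := LinearMap.congr_fun h1 (cop x)
  simp only [LinearMap.comp_apply, LinearEquiv.coe_coe] at h3
  rw [h2] at h3
  rw [actL, LinearMap.comp_apply, h3, LinearMap.rTensor_comp_apply]

lemma comul_actR (f : K →ₗ[k] k) (x : K) :
    cop (actR f x) = (actR f).lTensor K (cop x) := by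
  have h1 : cop ∘ₗ evalRight f = (evalRight f).lTensor K ∘ₗ
      (TensorProduct.assoc k K K K).toLinearMap ∘ₗ (cop).rTensor K := by
    apply TensorProduct.ext'
    intro a b
    simp only [LinearMap.comp_apply, evalRight_tmul, map_smul, LinearMap.rTensor_tmul]
    induction cop a using TensorProduct.induction_on with
    | zero => simp
    | add u v hu hv => rw [smul_add, hu, hv, TensorProduct.add_tmul, map_add, map_add]
    | tmul u v => simp
  have h2 := congrArg ((evalRight f).lTensor K) (Coalgebra.coassoc_apply (R := k) x)
  have h3 := LinearMap.congr_fun h1 (cop x)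
  simp only [LinearMap.comp_apply, LinearEquiv.coe_coe] at h3
  rw [h2] at h3
  rw [actR, LinearMap.comp_apply, h3, LinearMap.lTensor_comp_apply]

@[simp] lemma actL_counit (x : K) : actL (Coalgebra.counit (R := k)) x = x := by
  simp [actL, evalLeft]

@[simp] lemma actR_counit (x : K) : actR (Coalgebra.counit (R := k)) x = x := by
  simp [actR, evalRight]

/-- If `G` convolved with the identity is `F`, then `G` is `F` convolved with the antipode. -/
lemma eq_conv_antipode {F G : K →ₗ[k] K}
    (h : ∀ y, LinearMap.mul' k K (G.rTensor K (cop y)) = F y) (y : K) :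
    G y = LinearMap.mul' k K (TensorProduct.map F anti (cop y)) := by
  have h1 : toConv G * toConv LinearMap.id = toConv F := by
    apply WithConv.ofConv_injective; ext y; exact h y
  have h2 : toConv G = toConv F * toConv anti := by
    rw [← h1, mul_assoc, LinearMap.id_mul_antipode, mul_one]
  exact LinearMap.congr_fun (congrArg ofConv h2) y

lemma eq_antipode_conv {F G : K →ₗ[k] K}
    (h : ∀ y, LinearMap.mul' k K (G.lTensor K (cop y)) = F y) (y : K) :
    G y = LinearMap.mul' k K (TensorProduct.map anti F (cop y)) := by
  have h1 : toConv LinearMap.id * toConv G = toConv F := by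
    apply WithConv.ofConv_injective; ext y; exact h y
  have h2 : toConv G = toConv anti * toConv F := by
    rw [← h1, ← mul_assoc, LinearMap.antipode_mul_id, one_mul]
  exact LinearMap.congr_fun (congrArg ofConv h2) y

lemma eq_id_conv {F G : K →ₗ[k] K}
    (h : ∀ y, LinearMap.mul' k K (TensorProduct.map anti G (cop y)) = F y) (y : K) :
    G y = LinearMap.mul' k K (F.lTensor K (cop y)) := by
  have h1 : toConv anti * toConv G = toConv F := by
    apply WithConv.ofConv_injective; ext y; exact h y
  have h2 : toConv G = toConv LinearMap.id * toConv F := by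
    rw [← h1, ← mul_assoc, LinearMap.id_mul_antipode, one_mul]
  exact LinearMap.congr_fun (congrArg ofConv h2) y

section Integral

lemma evalLeft_mul (f : K →ₗ[k] k) (w : K ⊗[k] K) (b : K) :
    evalLeft f w * b = evalLeft f (w * (1 ⊗ₜ b)) := by
  induction w using TensorProduct.induction_on with
  | zero => simp
  | add u v hu hv => simp only [add_mul, map_add, hu, hv]
  | tmul u v => simp

lemma mul_evalLeft (f : K →ₗ[k] k) (w : K ⊗[k] K) (b : K) :
    b * evalLeft f w = evalLeft f ((1 ⊗ₜ b) * w) := by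
  induction w using TensorProduct.induction_on with
  | zero => simp
  | add u v hu hv => simp only [mul_add, map_add, hu, hv]
  | tmul u v => simp

lemma mul_evalRight (f : K →ₗ[k] k) (w : K ⊗[k] K) (b : K) :
    b * evalRight f w = evalRight f ((b ⊗ₜ 1) * w) := by
  induction w using TensorProduct.induction_on with
  | zero => simp
  | add u v hu hv => simp only [mul_add, map_add, hu, hv]
  | tmul u v => simp

/-- A right integral: `lam x₁ • x₂ = lam x • 1`. -/
def IsRightInt (lam : K →ₗ[k] k) : Prop := ∀ x, actL lam x = lam x • (1 : K)

lemma IsRightInt.evalLeft_comul_mul {lam : K →ₗ[k] k} (hl : IsRightInt lam) (x y : K) :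
    evalLeft lam (cop x * (y ⊗ₜ 1)) = anti (evalLeft lam ((x ⊗ₜ 1) * cop y)) := by
  have h := eq_conv_antipode (k := k) (K := K)
    (G := evalLeft lam ∘ₗ LinearMap.mulLeft k (cop x) ∘ₗ (inc₁).toLinearMap)
    (F := (lam ∘ₗ LinearMap.mulLeft k x).smulRight 1) ?_ y
  · refine (Eq.trans ?_ h).trans ?_
    · simp
    · induction cop y using TensorProduct.induction_on with
      | zero => simp
      | add u v hu hv => simp only [mul_add, map_add, hu, hv]
      | tmul u v => simp
  · intro y
    have : ∀ u : K ⊗[k] K, LinearMap.mul' k K ((evalLeft lam ∘ₗ LinearMap.mulLeft k (cop x) ∘ₗ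
        (inc₁).toLinearMap).rTensor K u) = evalLeft lam (cop x * u) := by
      intro u
      induction u using TensorProduct.induction_on with
      | zero => simp
      | add u v hu hv => simp only [mul_add, map_add, hu, hv]
      | tmul u v => simp [evalLeft_mul, mul_assoc]
    rw [this, ← Bialgebra.comul_mul]
    exact hl (x * y)

lemma evalRight_mul_comul {lam : K →ₗ[k] k} {g : K} (hg : ∀ x, actR lam x = lam x • g)
    (x y : K) :
    evalRight lam ((1 ⊗ₜ y) * cop x) = anti (evalRight lam (cop y * (1 ⊗ₜ x))) * g := by
  have h := eq_antipode_conv (k := k) (K := K)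
    (G := evalRight lam ∘ₗ LinearMap.mulRight k (cop x) ∘ₗ (inc₂).toLinearMap)
    (F := (lam ∘ₗ LinearMap.mulRight k x).smulRight g) ?_ y
  · refine (Eq.trans ?_ h).trans ?_
    · simp
    · induction cop y using TensorProduct.induction_on with
      | zero => simp
      | add u v hu hv => simp only [add_mul, map_add, hu, hv]
      | tmul u v => simp
  · intro y
    have : ∀ u : K ⊗[k] K, LinearMap.mul' k K ((evalRight lam ∘ₗ LinearMap.mulRight k (cop x) ∘ₗ
        (inc₂).toLinearMap).lTensor K u) = evalRight lam (u * cop x) := by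
      intro u
      induction u using TensorProduct.induction_on with
      | zero => simp
      | add u v hu hv => simp only [add_mul, map_add, hu, hv]
      | tmul u v => simp [mul_evalRight, ← mul_assoc]
    rw [this, ← Bialgebra.comul_mul]
    exact hg (y * x)

lemma IsRightInt.evalLeft_antipode_mul_comul {lam : K →ₗ[k] k} (hl : IsRightInt lam) (x z : K) :
    evalLeft lam ((anti z ⊗ₜ 1) * cop x) =
      evalRight (lam ∘ₗ LinearMap.mulRight k x ∘ₗ anti) (cop z) := by
  have h := eq_id_conv (k := k) (K := K)
    (G := evalLeft lam ∘ₗ LinearMap.mulRight k (cop x) ∘ₗ (inc₁).toLinearMap ∘ₗ anti)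
    (F := (lam ∘ₗ LinearMap.mulRight k x ∘ₗ anti).smulRight 1) ?_ z
  · refine (Eq.trans ?_ h).trans ?_
    · simp
    · induction cop z using TensorProduct.induction_on with
      | zero => simp
      | add u v hu hv => simp only [map_add, hu, hv]
      | tmul u v => simp
  · intro z
    have : ∀ u : K ⊗[k] K, LinearMap.mul' k K (TensorProduct.map anti
        (evalLeft lam ∘ₗ LinearMap.mulRight k (cop x) ∘ₗ (inc₁).toLinearMap ∘ₗ anti) u) =
          evalLeft lam (TensorProduct.map anti anti (TensorProduct.comm k K K u) * cop x) := by
      intro u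
      induction u using TensorProduct.induction_on with
      | zero => simp
      | add u v hu hv => simp only [add_mul, map_add, hu, hv]
      | tmul u v => simp [mul_evalLeft, ← mul_assoc]
    rw [this, ← comul_antipode, ← Bialgebra.comul_mul]
    exact hl (anti z * x)

/-- `z ↦ lam (S z * ·)`. -/
def toDual (lam : K →ₗ[k] k) : K →ₗ[k] (K →ₗ[k] k) :=
  (LinearMap.mul k K ∘ₗ anti).compr₂ lam

@[simp] lemma toDual_apply (lam : K →ₗ[k] k) (z x : K) : toDual lam z x = lam (anti z * x) := rfl

lemma IsRightInt.evalLeft_toDual {lam : K →ₗ[k] k} (hl : IsRightInt lam) (x z : K) :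
    actL (toDual lam z) x =
      dualTensorHom k K K (TensorProduct.comm k _ _ ((toDual lam).lTensor K (cop z))) x := by
  have h := hl.evalLeft_antipode_mul_comul x z
  have h1 : actL (toDual lam z) x = evalLeft lam ((anti z ⊗ₜ 1) * cop x) := by
    simp only [actL, LinearMap.comp_apply]
    induction cop x using TensorProduct.induction_on with
    | zero => simp
    | add u v hu hv => simp only [mul_add, map_add, hu, hv]
    | tmul u v => simp
  rw [h1, h]
  induction cop z using TensorProduct.induction_on with
  | zero => simp
  | add u v hu hv => simp only [map_add, hu, hv, LinearMap.add_apply]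
  | tmul u v => simp [dualTensorHom_apply]

lemma eq_of_lTensor_toDual {lam : K →ₗ[k] k} {e : (K →ₗ[k] k) →ₗ[k] k}
    (he : e ∘ₗ toDual lam = Coalgebra.counit) (z : K) :
    TensorProduct.rid k K (e.lTensor K ((toDual lam).lTensor K (cop z))) = z := by
  rw [← LinearMap.lTensor_comp_apply, he]
  simp

lemma apply_actL (f h : K →ₗ[k] k) (x : K) : f (actL h x) = h (actR f x) := by
  simp only [actL, actR, LinearMap.comp_apply]
  induction cop x using TensorProduct.induction_on with
  | zero => simp
  | add u v hu hv => simp only [map_add, hu, hv]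
  | tmul u v => simp [mul_comm]

lemma evalLeft_rTensor (f : K →ₗ[k] k) (u : K →ₗ[k] K) (t : K ⊗[k] K) :
    evalLeft f (u.rTensor K t) = evalLeft (f ∘ₗ u) t := by
  simp [evalLeft, LinearMap.rTensor_comp_apply]

lemma evalRight_lTensor (f : K →ₗ[k] k) (u : K →ₗ[k] K) (t : K ⊗[k] K) :
    evalRight f (u.lTensor K t) = evalRight (f ∘ₗ u) t := by
  simp [evalRight, LinearMap.lTensor_comp_apply]

lemma actL_actL (f h : K →ₗ[k] k) (x : K) : actL f (actL h x) = actL (f ∘ₗ actL h) x := by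
  conv_lhs => rw [actL, LinearMap.comp_apply, comul_actL, evalLeft_rTensor]
  rfl

lemma actR_actR (f h : K →ₗ[k] k) (x : K) : actR f (actR h x) = actR (f ∘ₗ actR h) x := by
  conv_lhs => rw [actR, LinearMap.comp_apply, comul_actR, evalRight_lTensor]
  rfl

variable [FiniteDimensional k K]

lemma dualTensorHom_comm_injective :
    Function.Injective fun t : K ⊗[k] (K →ₗ[k] k) =>
      dualTensorHom k K K (TensorProduct.comm k _ _ t) := by
  have : Function.Injective (dualTensorHom k K K) :=
    (dualTensorHomEquiv k K K).injective
  exact this.comp (TensorProduct.comm k _ _).injective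

lemma IsRightInt.counit_eq_zero {lam : K →ₗ[k] k} (hl : IsRightInt lam) (h0 : lam ≠ 0) (z : K)
    (hz : toDual lam z = 0) : Coalgebra.counit (R := k) z = 0 := by
  have h1 : (toDual lam).lTensor K (cop z) = 0 := by
    apply dualTensorHom_comm_injective (k := k)
    ext x
    simp only
    rw [← hl.evalLeft_toDual, hz]
    simp [actL, evalLeft]
  by_contra hne
  apply h0
  ext x
  have h2 : LinearMap.applyₗ x ∘ₗ toDual lam ∘ₗ LinearMap.mul' k K ∘ₗ (anti).rTensor K =
      TensorProduct.lift (LinearMap.applyₗ ∘ₗ LinearMap.mulRight k x ∘ₗ anti ∘ₗ anti) ∘ₗ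
        (toDual lam).lTensor K := by
    ext a b
    simp [HopfAlgebra.antipode_mul_antidistrib, mul_assoc]
  have h3 := LinearMap.congr_fun h2 (cop z)
  simp only [LinearMap.comp_apply, h1, map_zero,
    HopfAlgebra.mul_antipode_rTensor_comul_apply] at h3
  simpa [Algebra.algebraMap_eq_smul_one, hne] using h3

lemma IsRightInt.exists_counit {lam : K →ₗ[k] k} (hl : IsRightInt lam) (h0 : lam ≠ 0) :
    ∃ e : (K →ₗ[k] k) →ₗ[k] k, e ∘ₗ toDual lam = Coalgebra.counit := by
  have : (Coalgebra.counit (R := k) (A := K)) ∈ LinearMap.range (toDual lam).dualMap := by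
    rw [LinearMap.range_dualMap_eq_dualAnnihilator_ker, Submodule.mem_dualAnnihilator]
    exact fun z hz => hl.counit_eq_zero h0 z hz
  exact this

lemma IsRightInt.toDual_bijective {lam : K →ₗ[k] k} (hl : IsRightInt lam) (h0 : lam ≠ 0) :
    Function.Bijective (toDual lam) := by
  have inj : Function.Injective (toDual lam) := by
    rw [injective_iff_map_eq_zero]
    intro z hz
    obtain ⟨e, he⟩ := hl.exists_counit h0
    have h1 : (toDual lam).lTensor K (cop z) = 0 := by
      apply dualTensorHom_comm_injective (k := k)
      ext x
      simp only
      rw [← hl.evalLeft_toDual, hz]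
      simp [actL, evalLeft]
    rw [← eq_of_lTensor_toDual he z, h1]
    simp
  exact ⟨inj, (LinearMap.injective_iff_surjective_of_finrank_eq_finrank
    (Subspace.dual_finrank_eq (K := k) (V := K)).symm).mp inj⟩

/-- Integrals are unique up to scalars. -/
lemma IsRightInt.eq_smul {lam lam' : K →ₗ[k] k} (hl : IsRightInt lam) (h0 : lam ≠ 0)
    (hl' : IsRightInt lam') : ∃ c : k, lam' = c • lam := by
  obtain ⟨z, rfl⟩ := (hl.toDual_bijective h0).2 lam'
  obtain ⟨e, he⟩ := hl.exists_counit h0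
  have h1 : (toDual lam).lTensor K (cop z) = 1 ⊗ₜ toDual lam z := by
    apply dualTensorHom_comm_injective (k := k)
    ext x
    simp only
    rw [← hl.evalLeft_toDual, hl' x]
    simp [dualTensorHom_apply]
  have h2 := eq_of_lTensor_toDual he z
  rw [h1] at h2
  refine ⟨e (toDual lam z), ?_⟩
  have h3 : z = e (toDual lam z) • 1 := by simpa using h2.symm
  ext x
  rw [toDual_apply]
  conv_lhs => rw [h3]
  simp

lemma IsRightInt.exists_groupLike {lam : K →ₗ[k] k} (hl : IsRightInt lam) (h0 : lam ≠ 0) :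
    ∃ g : K, IsGroupLikeElem k g ∧ ∀ x, actR lam x = lam x • g := by
  obtain ⟨x₀, hx₀⟩ : ∃ x, lam x = 1 := LinearMap.surjective h0 1
  have hg : ∀ x, actR lam x = lam x • actR lam x₀ := by
    intro x
    rw [← sub_eq_zero, ← Module.forall_dual_apply_eq_zero_iff k]
    intro f
    rw [map_sub, sub_eq_zero]
    have hintegral : IsRightInt (lam ∘ₗ actL f) := by
      intro y
      rw [← actL_actL, hl]
      rfl
    obtain ⟨c, hc⟩ := hl.eq_smul h0 hintegral
    have h1 : ∀ y, f (actR lam y) = c * lam y := by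
      intro y
      rw [← apply_actL]
      exact LinearMap.congr_fun hc y
    rw [map_smul, h1, h1, hx₀, smul_eq_mul, mul_one, mul_comm]
  refine ⟨actR lam x₀, ⟨?_, ?_⟩, hg⟩
  · rw [← apply_actL, actL_counit, hx₀]
  · have h1 : actR lam = lam.smulRight (actR lam x₀) := by ext x; exact hg x
    rw [comul_actR]
    conv_lhs => rw [h1]
    have : ∀ t : K ⊗[k] K, (lam.smulRight (actR lam x₀)).lTensor K t
        = evalRight lam t ⊗ₜ actR lam x₀ := by
      intro t
      induction t using TensorProduct.induction_on with
      | zero => simp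
      | add u v hu hv => simp only [map_add, hu, hv, TensorProduct.add_tmul]
      | tmul u v => simp [TensorProduct.smul_tmul']
    rw [this]
    rfl

end Integral

section Antipode

/-- The antiendomorphism `a ⊗ b ↦ S b ⊗ S a` of `K ⊗ K`. -/
def antiTensor : K ⊗[k] K →ₗ[k] K ⊗[k] K :=
  TensorProduct.map anti anti ∘ₗ (TensorProduct.comm k K K).toLinearMap

@[simp] lemma antiTensor_tmul (a b : K) :
    antiTensor (k := k) (a ⊗ₜ b) = anti b ⊗ₜ anti a := by simp [antiTensor]

lemma antiTensor_mul (s t : K ⊗[k] K) :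
    antiTensor (s * t) = antiTensor t * antiTensor s := by
  induction s using TensorProduct.induction_on with
  | zero => simp
  | add u v hu hv => simp only [add_mul, mul_add, map_add, hu, hv]
  | tmul a b =>
    induction t using TensorProduct.induction_on with
    | zero => simp
    | add u v hu hv => simp only [add_mul, mul_add, map_add, hu, hv]
    | tmul c d => simp [HopfAlgebra.antipode_mul_antidistrib]

lemma comul_antipode_conv_includeLeft (y : K) :
    LinearMap.mul' k (K ⊗[k] K) (TensorProduct.map (cop ∘ₗ anti) (inc₁).toLinearMap (cop y)) =
      1 ⊗ₜ anti y := by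
  have h : toConv (cop ∘ₗ anti) * toConv (inc₁).toLinearMap =
      toConv ((inc₂).toLinearMap ∘ₗ anti) := by
    rw [comul_antipode_conv, mul_assoc, algHom_antipode_conv_self, mul_one]
  exact LinearMap.congr_fun (congrArg ofConv h) y

/-- `(1 ⊗ S y₂) * Δ (S² y₁) = S² y ⊗ 1`. -/
lemma lift_antipode_mul_comul_antipode_sq (y : K) :
    LinearMap.mul' k (K ⊗[k] K) (TensorProduct.map ((inc₂).toLinearMap ∘ₗ anti)
      (cop ∘ₗ anti ∘ₗ anti) (TensorProduct.comm k K K (cop y))) = anti (anti y) ⊗ₜ 1 := by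
  have h := congrArg antiTensor (comul_antipode_conv_includeLeft (k := k) y)
  rw [antiTensor_tmul, HopfAlgebra.antipode_one] at h
  rw [← h]
  induction cop y using TensorProduct.induction_on with
  | zero => simp
  | add u v hu hv => simp only [map_add, hu, hv]
  | tmul a b =>
    simp only [TensorProduct.comm_tmul, TensorProduct.map_tmul, LinearMap.mul'_apply,
      antiTensor_mul, LinearMap.comp_apply, AlgHom.toLinearMap_apply,
      Algebra.TensorProduct.includeRight_apply, Algebra.TensorProduct.includeLeft_apply,
      antiTensor_tmul, HopfAlgebra.antipode_one]
    rw [comul_antipode (anti a)]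
    rfl

lemma actR_actL_comm (p f : K →ₗ[k] k) (y : K) : actR p (actL f y) = actL f (actR p y) := by
  conv_lhs => rw [actR, LinearMap.comp_apply, comul_actL]
  conv_rhs => rw [actR, LinearMap.comp_apply]
  induction cop y using TensorProduct.induction_on with
  | zero => simp
  | add u v hu hv => simp only [map_add, hu, hv]
  | tmul a b => simp

lemma sum_apply_mul_coord {ι : Type*} [Fintype ι] (b : Module.Basis ι k K) (h : K →ₗ[k] k)
    (a c : K) : ∑ j, h (a * b j) * b.coord j c = h (a * c) := by
  conv_rhs => rw [← b.sum_repr c]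
  rw [Finset.mul_sum, map_sum]
  exact Finset.sum_congr rfl fun j _ => by simp [mul_comm]

/-- `y ↦ S² y * x`. -/
def sqMul (x : K) : Module.End k K := LinearMap.mulRight k x ∘ₗ anti ∘ₗ anti

lemma sum_actR_sqMul {ι : Type*} [Fintype ι] (b : Module.Basis ι k K) (h : K →ₗ[k] k) (x y : K) :
    ∑ j, actR (b.coord j) (sqMul (k := k) x (actR (h ∘ₗ LinearMap.mulRight k (b j) ∘ₗ anti) y)) =
      sqMul (k := k) (actR h x) y := by
  have h1 := lift_antipode_mul_comul_antipode_sq (k := k) y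
  have h2 : sqMul (k := k) (actR h x) y = evalRight h ((anti (anti y) ⊗ₜ 1) * cop x) := by
    rw [← mul_evalRight]; rfl
  rw [h2, ← h1]
  conv_lhs => enter [2, j]; rw [actR, actR, LinearMap.comp_apply, LinearMap.comp_apply]
  induction cop y using TensorProduct.induction_on with
  | zero => simp
  | add u v hu hv => simp only [map_add, add_mul, Finset.sum_add_distrib, hu, hv]
  | tmul a c =>
    simp only [evalRight_tmul, map_smul, sqMul, LinearMap.comp_apply, LinearMap.mulRight_apply,
      Bialgebra.comul_mul, TensorProduct.comm_tmul, TensorProduct.map_tmul, LinearMap.mul'_apply,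
      AlgHom.toLinearMap_apply, Algebra.TensorProduct.includeRight_apply, mul_assoc]
    induction cop (anti (anti a)) * cop x using TensorProduct.induction_on with
    | zero => simp
    | add u v hu hv => simp only [map_add, mul_add, smul_add, Finset.sum_add_distrib, hu, hv]
    | tmul u v =>
      simp only [evalRight_tmul, Algebra.TensorProduct.tmul_mul_tmul, one_mul, smul_smul]
      rw [← Finset.sum_smul, sum_apply_mul_coord]

lemma sum_actR_actR {ι : Type*} [Fintype ι] (b : Module.Basis ι k K) (h : K →ₗ[k] k) (y : K) :
    ∑ j, actR (h ∘ₗ LinearMap.mulRight k (b j) ∘ₗ anti) (actR (b.coord j) y) = h 1 • y := by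
  have key : ∀ t : K ⊗[k] K, ∑ j, (h ∘ₗ LinearMap.mulRight k (b j) ∘ₗ anti)
      (evalRight (b.coord j) t) = h (LinearMap.mul' k K ((anti).rTensor K t)) := by
    intro t
    induction t using TensorProduct.induction_on with
    | zero => simp
    | add u v hu hv => simp only [map_add, Finset.sum_add_distrib, hu, hv]
    | tmul u v =>
      simp only [evalRight_tmul, map_smul, LinearMap.comp_apply, LinearMap.mulRight_apply,
        smul_eq_mul, LinearMap.rTensor_tmul, LinearMap.mul'_apply]
      rw [← sum_apply_mul_coord b h]
      exact Finset.sum_congr rfl fun j _ => mul_comm _ _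
  simp only [actR_actR]
  have h1 : ∀ z, ∑ j, (h ∘ₗ LinearMap.mulRight k (b j) ∘ₗ anti) (actR (b.coord j) z) =
      h 1 * Coalgebra.counit (R := k) z := by
    intro z
    refine (key (cop z)).trans ?_
    rw [HopfAlgebra.mul_antipode_rTensor_comul_apply, Algebra.algebraMap_eq_smul_one, map_smul,
      smul_eq_mul, mul_comm]
  have h2 : ∀ t : K ⊗[k] K, ∑ j, evalRight ((h ∘ₗ LinearMap.mulRight k (b j) ∘ₗ anti) ∘ₗ
      actR (b.coord j)) t = h 1 • evalRight (Coalgebra.counit (R := k)) t := by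
    intro t
    induction t using TensorProduct.induction_on with
    | zero => simp
    | add u v hu hv => simp only [map_add, smul_add, Finset.sum_add_distrib, hu, hv]
    | tmul u v =>
      simp only [evalRight_tmul]
      rw [← Finset.sum_smul, smul_smul]
      exact congrArg (· • u) (h1 v)
  refine (h2 (cop y)).trans ?_
  exact congrArg (h 1 • ·) (actR_counit y)

/-- The functional `x ↦ Tr (y ↦ S² (f y₁ • y₂) * x)`. -/
def traceFunctional (f : K →ₗ[k] k) : K →ₗ[k] k :=
  LinearMap.trace k K ∘ₗ
    { toFun := fun x => sqMul x * actL f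
      map_add' := fun x y => by ext; simp [sqMul, mul_add]
      map_smul' := fun c x => by ext; simp [sqMul] }

lemma traceFunctional_apply (f : K →ₗ[k] k) (x : K) :
    traceFunctional f x = LinearMap.trace k K (sqMul x * actL f) := rfl

/-- `y ↦ S y₂ * v y₁`. -/
def twist (v : Module.End k K) : Module.End k K :=
  LinearMap.mul' k K ∘ₗ TensorProduct.map anti v ∘ₗ (TensorProduct.comm k K K).toLinearMap ∘ₗ cop

lemma antipode_sq_mul_twist (v : Module.End k K) (y : K) :
    LinearMap.mul' k K (TensorProduct.map (anti ∘ₗ anti) (twist v)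
      (TensorProduct.comm k K K (cop y))) = v y := by
  let N : (K ⊗[k] K) ⊗[k] K →ₗ[k] K := LinearMap.mul' k K ∘ₗ TensorProduct.map (anti ∘ₗ anti)
      (LinearMap.mul' k K ∘ₗ TensorProduct.map anti v ∘ₗ (TensorProduct.comm k K K).toLinearMap) ∘ₗ
      (TensorProduct.comm k (K ⊗[k] K) K).toLinearMap
  have h1 : LinearMap.mul' k K (TensorProduct.map (anti ∘ₗ anti) (twist v)
      (TensorProduct.comm k K K (cop y))) = N ((cop).rTensor K (cop y)) := by
    induction cop y using TensorProduct.induction_on with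
    | zero => simp
    | add u v hu hv => simp only [map_add, hu, hv]
    | tmul a b => simp [N, twist]
  have h2 : N ∘ₗ (TensorProduct.assoc k K K K).symm.toLinearMap ∘ₗ (cop).lTensor K =
      LinearMap.mul' k K ∘ₗ TensorProduct.map (Algebra.linearMap k K ∘ₗ Coalgebra.counit) v ∘ₗ
        (TensorProduct.comm k K K).toLinearMap := by
    apply TensorProduct.ext'
    intro a b
    have h3 : ∀ t : K ⊗[k] K, N ((TensorProduct.assoc k K K K).symm (a ⊗ₜ t)) =
        anti (LinearMap.mul' k K ((anti).lTensor K t)) * v a := by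
      intro t
      induction t using TensorProduct.induction_on with
      | zero => simp
      | add u v hu hv => simp only [TensorProduct.tmul_add, map_add, add_mul, hu, hv]
      | tmul c d => simp [N, HopfAlgebra.antipode_mul_antidistrib, mul_assoc]
    have := h3 (cop b)
    rw [HopfAlgebra.mul_antipode_lTensor_comul_apply] at this
    refine Eq.trans this ?_
    simp [Algebra.algebraMap_eq_smul_one]
  rw [h1, ← Coalgebra.coassoc_symm_apply]
  refine (LinearMap.congr_fun h2 (cop y)).trans ?_
  have h4 : ∀ t : K ⊗[k] K, (LinearMap.mul' k K ∘ₗ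
      TensorProduct.map (Algebra.linearMap k K ∘ₗ Coalgebra.counit) v ∘ₗ
        (TensorProduct.comm k K K).toLinearMap) t = v (evalRight Coalgebra.counit t) := by
    intro t
    induction t using TensorProduct.induction_on with
    | zero => simp
    | add u v hu hv => simp only [map_add, hu, hv]
    | tmul c d => simp [Algebra.algebraMap_eq_smul_one]
  rw [h4]
  exact congrArg v (actR_counit y)

lemma sum_traceFunctional {ι : Type*} [Fintype ι] (b : Module.Basis ι k K) (v : Module.End k K) :
    ∑ j, traceFunctional (b.coord j ∘ₗ twist v) (b j) = LinearMap.trace k K v := by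
  simp only [traceFunctional_apply]
  rw [← map_sum]
  congr 1
  ext y
  rw [← antipode_sq_mul_twist v y]
  simp only [LinearMap.sum_apply, Module.End.mul_apply, actL, LinearMap.comp_apply]
  induction cop y using TensorProduct.induction_on with
  | zero => simp
  | add u v hu hv => simp only [map_add, Finset.sum_add_distrib, hu, hv]
  | tmul c d =>
    simp only [evalLeft_tmul, sqMul, LinearMap.comp_apply, TensorProduct.comm_tmul,
      TensorProduct.map_tmul, LinearMap.mul'_apply, map_smul, LinearMap.mulRight_apply]
    conv_rhs => rw [← b.sum_repr (twist v c)]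
    rw [Finset.mul_sum]
    exact Finset.sum_congr rfl fun j _ => by simp

variable [FiniteDimensional k K]

lemma isRightInt_traceFunctional (f : K →ₗ[k] k) : IsRightInt (traceFunctional f) := by
  intro x
  rw [← sub_eq_zero, ← Module.forall_dual_apply_eq_zero_iff k]
  intro h
  rw [map_sub, sub_eq_zero, apply_actL, map_smul, smul_eq_mul, traceFunctional_apply,
    traceFunctional_apply]
  let b := Module.finBasis k K
  have h1 : sqMul (k := k) (actR h x) = ∑ j, actR (b.coord j) *
      (sqMul (k := k) x * actR (h ∘ₗ LinearMap.mulRight k (b j) ∘ₗ anti)) := by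
    ext y
    rw [← sum_actR_sqMul b]
    simp
  have h2 : ∑ j, actR (h ∘ₗ LinearMap.mulRight k (b j) ∘ₗ anti) * actR (b.coord j) =
      h 1 • (1 : Module.End k K) := by
    ext y
    simpa using sum_actR_actR b h y
  have h3 : ∀ j, LinearMap.trace k K (actR (b.coord j) *
      (sqMul (k := k) x * actR (h ∘ₗ LinearMap.mulRight k (b j) ∘ₗ anti)) * actL f) =
      LinearMap.trace k K (sqMul x * actL f *
        (actR (h ∘ₗ LinearMap.mulRight k (b j) ∘ₗ anti) * actR (b.coord j))) := by
    intro j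
    rw [mul_assoc, LinearMap.trace_mul_comm]
    congr 1
    ext y
    simp only [Module.End.mul_apply, actR_actL_comm]
  rw [h1, Finset.sum_mul, map_sum, Finset.sum_congr rfl fun j _ => h3 j, ← map_sum,
    ← Finset.mul_sum, h2]
  simp [mul_comm]

lemma exists_isRightInt [Nontrivial K] : ∃ lam : K →ₗ[k] k, IsRightInt lam ∧ lam ≠ 0 := by
  by_contra! hcon
  obtain ⟨f, hf⟩ : ∃ f : K →ₗ[k] k, f 1 = 1 :=
    Module.Projective.exists_dual_eq_one k one_ne_zero
  have h := sum_traceFunctional (Module.finBasis k K) (f.smulRight 1)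
  rw [LinearMap.trace_smulRight, hf] at h
  simp [hcon _ (isRightInt_traceFunctional _)] at h

end Antipode

section Radford

lemma evalLeft_comp_mulLeft (lam : K →ₗ[k] k) (a : K) (w : K ⊗[k] K) :
    evalLeft (lam ∘ₗ LinearMap.mulLeft k a) w = evalLeft lam ((a ⊗ₜ 1) * w) := by
  induction w using TensorProduct.induction_on with
  | zero => simp
  | add u v hu hv => simp only [map_add, mul_add, hu, hv]
  | tmul a b => simp

lemma evalLeft_comp_mulRight (lam : K →ₗ[k] k) (a : K) (w : K ⊗[k] K) :
    evalLeft (lam ∘ₗ LinearMap.mulRight k a) w = evalLeft lam (w * (a ⊗ₜ 1)) := by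
  induction w using TensorProduct.induction_on with
  | zero => simp
  | add u v hu hv => simp only [map_add, add_mul, hu, hv]
  | tmul a b => simp

lemma evalRight_comp_mulLeft (lam : K →ₗ[k] k) (a : K) (w : K ⊗[k] K) :
    evalRight (lam ∘ₗ LinearMap.mulLeft k a) w = evalRight lam ((1 ⊗ₜ a) * w) := by
  induction w using TensorProduct.induction_on with
  | zero => simp
  | add u v hu hv => simp only [map_add, mul_add, hu, hv]
  | tmul a b => simp

lemma evalRight_comp_mulRight (lam : K →ₗ[k] k) (a : K) (w : K ⊗[k] K) :
    evalRight (lam ∘ₗ LinearMap.mulRight k a) w = evalRight lam (w * (1 ⊗ₜ a)) := by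
  induction w using TensorProduct.induction_on with
  | zero => simp
  | add u v hu hv => simp only [map_add, add_mul, hu, hv]
  | tmul a b => simp

variable [FiniteDimensional k K]

lemma IsRightInt.exists_mulLeft_eq {lam : K →ₗ[k] k} (hl : IsRightInt lam) (h0 : lam ≠ 0)
    (f : K →ₗ[k] k) : ∃ z, lam ∘ₗ LinearMap.mulLeft k z = f := by
  obtain ⟨z, rfl⟩ := (hl.toDual_bijective h0).2 f
  exact ⟨anti z, by ext; simp⟩

lemma IsRightInt.mulRight_injective {lam : K →ₗ[k] k} (hl : IsRightInt lam) (h0 : lam ≠ 0)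
    {x y : K} (h : ∀ z, lam (z * x) = lam (z * y)) : x = y := by
  rw [← sub_eq_zero, ← Module.forall_dual_apply_eq_zero_iff k]
  intro f
  obtain ⟨z, rfl⟩ := hl.exists_mulLeft_eq h0 f
  simp [mul_sub, h]

lemma IsRightInt.exists_nakayama {lam : K →ₗ[k] k} (hl : IsRightInt lam) (h0 : lam ≠ 0) :
    ∃ N : K →ₐ[k] K, ∀ x y, lam (x * y) = lam (y * N x) := by
  let R : K →ₗ[k] (K →ₗ[k] k) := (LinearMap.mul k K).flip.compr₂ lam
  have hR : Function.Injective R := by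
    intro x y hxy
    exact hl.mulRight_injective h0 fun z => LinearMap.congr_fun hxy z
  let e : K ≃ₗ[k] (K →ₗ[k] k) := LinearEquiv.ofInjectiveOfFinrankEq R hR
    (Subspace.dual_finrank_eq (K := k) (V := K)).symm
  let N : K →ₗ[k] K := e.symm.toLinearMap ∘ₗ (LinearMap.mul k K).compr₂ lam
  have hN : ∀ x y, lam (x * y) = lam (y * N x) := by
    intro x y
    have : R (N x) = (LinearMap.mul k K).compr₂ lam x := e.apply_symm_apply _
    exact (LinearMap.congr_fun this y).symm
  refine ⟨AlgHom.ofLinearMap N ?_ ?_, hN⟩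
  · refine hl.mulRight_injective h0 fun z => ?_
    rw [← hN]; simp
  · intro a b
    refine hl.mulRight_injective h0 fun z => ?_
    rw [← hN, mul_assoc, hN, mul_assoc, hN, mul_assoc]

/-- Radford's formula for the fourth power of the antipode. -/
theorem exists_radford [Nontrivial K] :
    ∃ (g : K) (ν : K →ₐ[k] k), IsGroupLikeElem k g ∧ ∀ x,
      anti (anti (anti (anti (actR ν.toLinearMap x)))) = g * actL ν.toLinearMap x * anti g := by
  obtain ⟨lam, hl, h0⟩ := exists_isRightInt (k := k) (K := K)
  obtain ⟨g, hg, hgr⟩ := hl.exists_groupLike h0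
  obtain ⟨N, hN⟩ := hl.exists_nakayama h0
  obtain ⟨Λ, hΛ⟩ := hl.exists_mulLeft_eq h0 Coalgebra.counit
  let ν : K →ₐ[k] k := (Bialgebra.counitAlgHom k K).comp N
  have hcounit : ∀ w, lam (Λ * w) = Coalgebra.counit (R := k) w := LinearMap.congr_fun hΛ
  have hν : lam ∘ₗ LinearMap.mulRight k Λ = ν.toLinearMap := by
    ext x
    have := hN x Λ
    rw [hcounit] at this
    exact this
  have hcomm : ∀ x, lam ∘ₗ LinearMap.mulLeft k x = lam ∘ₗ LinearMap.mulRight k (N x) := by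
    intro x
    ext y
    exact hN x y
  have hTl : ∀ x, actL ν.toLinearMap x = anti (anti (N x)) := by
    intro x
    have h1 := hl.evalLeft_comul_mul x Λ
    rw [← evalLeft_comp_mulRight, hν, ← evalLeft_comp_mulLeft, hcomm, evalLeft_comp_mulRight,
      hl.evalLeft_comul_mul, ← evalLeft_comp_mulLeft, hΛ] at h1
    refine h1.trans ?_
    exact congrArg (fun z => anti (anti z)) (actL_counit (k := k) (N x))
  have hTr : ∀ x, N x = anti g * anti (anti (actR ν.toLinearMap x)) * g := by
    intro x
    have h1 := evalRight_mul_comul hgr (N x) Λ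
    rw [← evalRight_comp_mulLeft, hΛ, ← evalRight_comp_mulRight, ← hcomm, evalRight_comp_mulLeft,
      evalRight_mul_comul hgr, ← evalRight_comp_mulRight, hν,
      HopfAlgebra.antipode_mul_antidistrib] at h1
    exact (actR_counit (k := k) (N x)).symm.trans h1
  refine ⟨g, ν, hg, fun x => ?_⟩
  rw [hTl, hTr]
  have h1 := hg.mul_antipode_cancel
  have h2 := hg.antipode_antipode
  simp only [HopfAlgebra.antipode_mul_antidistrib, h2]
  rw [← mul_assoc, ← mul_assoc, h1, one_mul, mul_assoc, h1, mul_one]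

end Radford

section Translation

variable (ν : K →ₐ[k] k)

lemma actL_mul (x y : K) :
    actL ν.toLinearMap (x * y) = actL ν.toLinearMap x * actL ν.toLinearMap y := by
  simp only [actL, LinearMap.comp_apply, Bialgebra.comul_mul]
  generalize cop x = s
  generalize cop y = t
  induction s using TensorProduct.induction_on with
  | zero => simp
  | add u v hu hv => simp only [add_mul, map_add, hu, hv]
  | tmul a b =>
    induction t using TensorProduct.induction_on with
    | zero => simp
    | add u v hu hv => simp only [mul_add, map_add, hu, hv]
    | tmul c d => simp [smul_smul, mul_comm]

lemma actL_groupLike {g : K} (hg : IsGroupLikeElem k g) : actL ν.toLinearMap g = ν g • g := by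
  simp [actL, hg.comul_eq_tmul_self]

lemma actL_conj {g : K} (hg : IsGroupLikeElem k g) (x : K) :
    actL ν.toLinearMap (g * x * anti g) = g * actL ν.toLinearMap x * anti g := by
  have h : ν g * ν (anti g) = 1 := by rw [← map_mul, hg.mul_antipode_cancel, map_one]
  rw [actL_mul, actL_mul, actL_groupLike ν hg, actL_groupLike ν hg.antipode]
  simp [smul_smul, mul_comm, h]

lemma algHom_antipode_antipode (x : K) : ν (anti (anti x)) = ν x := by
  let μ : K →ₐ[k] k := AlgHom.ofLinearMap (ν.toLinearMap ∘ₗ anti) (by simp)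
    (fun a b => by simp [HopfAlgebra.antipode_mul_antidistrib, mul_comm])
  have h := left_inv_eq_right_inv (algHom_self_conv_antipode ν) (algHom_self_conv_antipode μ)
  exact (LinearMap.congr_fun (congrArg ofConv h) x).symm

lemma comul_antipode_antipode (x : K) : cop (anti (anti x)) =
    TensorProduct.map (anti ∘ₗ anti) (anti ∘ₗ anti) (cop x) := by
  rw [comul_antipode, comul_antipode]
  induction cop x using TensorProduct.induction_on with
  | zero => simp
  | add u v hu hv => simp only [map_add, hu, hv]
  | tmul a b => simp

lemma actR_antipode_antipode (x : K) :
    actR ν.toLinearMap (anti (anti x)) = anti (anti (actR ν.toLinearMap x)) := by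
  simp only [actR, LinearMap.comp_apply, comul_antipode_antipode]
  induction cop x using TensorProduct.induction_on with
  | zero => simp
  | add u v hu hv => simp only [map_add, hu, hv]
  | tmul a b => simp [algHom_antipode_antipode]

lemma actR_pow (j : ℕ) :
    actR ν.toLinearMap ^ j = actR (Coalgebra.counit ∘ₗ actL ν.toLinearMap ^ j) := by
  induction j with
  | zero => ext x; exact (actR_counit (k := k) x).symm
  | succ j ih =>
    ext x
    conv_lhs => rw [pow_succ', Module.End.mul_apply, ih, actR_actR]
    congr 2
    ext y
    simp only [LinearMap.comp_apply]
    rw [← apply_actL, pow_succ]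
    rfl

lemma actR_pow_eq_one {m : ℕ} (h : actL ν.toLinearMap ^ m = 1) : actR ν.toLinearMap ^ m = 1 := by
  rw [actR_pow, h]
  ext x
  exact actR_counit x

end Translation

section Galois

/-- `x ⊗ y ↦ x * F y₁ ⊗ y₂`. -/
def galois (F : Module.End k K) : Module.End k (K ⊗[k] K) :=
  (LinearMap.mul' k K).rTensor K ∘ₗ (TensorProduct.assoc k K K K).symm.toLinearMap ∘ₗ
    (F.rTensor K ∘ₗ cop).lTensor K

lemma galois_tmul (F : Module.End k K) (x y : K) :
    galois F (x ⊗ₜ y) = (x ⊗ₜ 1) * F.rTensor K (cop y) := by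
  simp only [galois, LinearMap.comp_apply, LinearMap.lTensor_tmul]
  induction cop y using TensorProduct.induction_on with
  | zero => simp
  | add u v hu hv => simp only [TensorProduct.tmul_add, map_add, hu, hv, mul_add]
  | tmul a b => simp

lemma galois_mul (F : Module.End k K) (x : K) (t : K ⊗[k] K) :
    galois F ((x ⊗ₜ 1) * t) = (x ⊗ₜ 1) * galois F t := by
  induction t using TensorProduct.induction_on with
  | zero => simp
  | add u v hu hv => simp only [map_add, hu, hv, mul_add]
  | tmul a b => simp [galois_tmul, ← mul_assoc]

lemma galois_galois (F G : Module.End k K) (t : K ⊗[k] K) :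
    galois F (galois G t) = galois (ofConv (toConv G * toConv F)) t := by
  induction t using TensorProduct.induction_on with
  | zero => simp
  | add u v hu hv => simp only [map_add, hu, hv]
  | tmul x y =>
    have h1 : galois F ∘ₗ G.rTensor K = (LinearMap.mul' k K ∘ₗ TensorProduct.map G F).rTensor K ∘ₗ
        (TensorProduct.assoc k K K K).symm.toLinearMap ∘ₗ (cop).lTensor K := by
      apply TensorProduct.ext'
      intro a b
      simp only [LinearMap.comp_apply, LinearMap.rTensor_tmul, LinearMap.lTensor_tmul, galois_tmul]
      induction cop b using TensorProduct.induction_on with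
      | zero => simp
      | add u v hu hv => simp only [TensorProduct.tmul_add, map_add, hu, hv, mul_add]
      | tmul c d => simp
    rw [galois_tmul, galois_mul, galois_tmul]
    congr 1
    have h2 := LinearMap.congr_fun h1 (cop y)
    simp only [LinearMap.comp_apply, LinearEquiv.coe_coe, Coalgebra.coassoc_symm_apply] at h2
    rw [h2, ← LinearMap.rTensor_comp_apply]
    rfl

lemma galois_one : galois (ofConv (1 : WithConv (K →ₗ[k] K))) = LinearMap.id := by
  apply TensorProduct.ext'
  intro x y
  rw [galois_tmul, LinearMap.convOne_def, LinearMap.rTensor_comp_apply,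
    Coalgebra.rTensor_counit_comul]
  simp

variable (k K) in
/-- The Galois map `x ⊗ y ↦ x * y₁ ⊗ y₂`. -/
def galoisEquiv : K ⊗[k] K ≃ₗ[k] K ⊗[k] K :=
  LinearEquiv.ofLinearMap (galois LinearMap.id) (galois anti)
    (by ext1; ext; simp [galois_galois, LinearMap.antipode_mul_id, galois_one])
    (by ext1; ext; simp [galois_galois, LinearMap.id_mul_antipode, galois_one])

lemma galoisEquiv_tmul (x y : K) : galoisEquiv k K (x ⊗ₜ y) = (x ⊗ₜ 1) * cop y := by
  simp [galoisEquiv, galois_tmul]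

/-- Group-like elements acting by inverse right translations. -/
def translation : Representation k (GroupLike k K) K where
  toFun g := LinearMap.mulRight k (g⁻¹ : GroupLike k K).val
  map_one' := by ext; simp
  map_mul' a b := by ext; simp [mul_assoc]

lemma groupLike_pow_finrank [FiniteDimensional k K] {g : K} (hg : IsGroupLikeElem k g) :
    g ^ Module.finrank k K = 1 := by
  have h := RepRank.pow_finrank_eq_one (translation (k := k) (K := K)) ⟨g, hg⟩ (v := 1) ?_
    (galoisEquiv k K).symm ?_
  · exact congrArg GroupLike.val h
  · have : Function.Injective fun h : Subgroup.zpowers (⟨g, hg⟩ : GroupLike k K) =>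
        (h : GroupLike k K)⁻¹ := inv_injective.comp Subtype.val_injective
    have h := (linearIndep_groupLikeVal (R := k) (A := K)).comp _ this
    have e : (fun w : Subgroup.zpowers (⟨g, hg⟩ : GroupLike k K) =>
        translation (k := k) (w : GroupLike k K) 1) = GroupLike.val ∘ fun w => w.1⁻¹ := by
      ext; simp [translation]
    rw [e]
    exact h
  · intro h a b
    rw [LinearEquiv.symm_apply_eq]
    obtain ⟨t, ht⟩ := (galoisEquiv k K).surjective (a ⊗ₜ b)
    rw [← ht, LinearEquiv.symm_apply_apply]
    have key : ∀ t : K ⊗[k] K, galoisEquiv k K ((translation h).lTensor K t) =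
        TensorProduct.map (translation h) (translation h) (galoisEquiv k K t) := by
      intro t
      induction t using TensorProduct.induction_on with
      | zero => simp
      | add u v hu hv => simp only [map_add, hu, hv]
      | tmul x y =>
        have hh : cop (h⁻¹ : GroupLike k K).val = (h⁻¹).val ⊗ₜ (h⁻¹).val :=
          (h⁻¹).2.comul_eq_tmul_self
        simp only [LinearMap.lTensor_tmul, galoisEquiv_tmul, translation, MonoidHom.coe_mk,
          OneHom.coe_mk, LinearMap.mulRight_apply, Bialgebra.comul_mul, hh]
        induction cop y using TensorProduct.induction_on with
        | zero => simp
        | add u v hu hv => simp only [add_mul, mul_add, map_add, hu, hv]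
        | tmul c d => simp [mul_assoc]
    rw [key, ht, TensorProduct.map_tmul]

lemma apply_actL_eq_convMul (h f : K →ₗ[k] k) :
    f ∘ₗ actL h = ofConv (toConv h * toConv f) := by
  ext x
  simp only [actL, LinearMap.comp_apply, LinearMap.convMul_def, ofConv_toConv]
  induction cop x using TensorProduct.induction_on with
  | zero => simp
  | add u v hu hv => simp only [map_add, hu, hv]
  | tmul a b => simp

variable (k K) in
/-- Characters acting on the dual by left convolution. -/
def dualTranslation : WithConv (K →ₐ[k] k) →* Module.End k (Module.Dual k K) where
  toFun μ := (actL μ.ofConv.toLinearMap).dualMap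
  map_one' := by
    ext1 f
    refine (apply_actL_eq_convMul _ f).trans ?_
    rw [AlgHom.toLinearMap_convOne, one_mul]
    rfl
  map_mul' μ ν := by
    ext1 f
    change f ∘ₗ actL (μ * ν).ofConv.toLinearMap =
      (f ∘ₗ actL ν.ofConv.toLinearMap) ∘ₗ actL μ.ofConv.toLinearMap
    rw [apply_actL_eq_convMul, apply_actL_eq_convMul, apply_actL_eq_convMul, toConv_ofConv,
      AlgHom.toLinearMap_convMul, mul_assoc]

lemma dualTranslation_apply (μ : WithConv (K →ₐ[k] k)) (f : Module.Dual k K) :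
    dualTranslation k K μ f = f ∘ₗ actL μ.ofConv.toLinearMap := rfl

/-- Characters of a Hopf algebra are invertible under convolution. -/
def charUnit (ν : K →ₐ[k] k) : (WithConv (K →ₐ[k] k))ˣ where
  val := toConv ν
  inv := toConv (AlgHom.ofLinearMap (ν.toLinearMap ∘ₗ anti) (by simp)
    (fun a b => by simp [HopfAlgebra.antipode_mul_antidistrib, mul_comm]))
  val_inv := by
    apply WithConv.ofConv_injective
    apply AlgHom.toLinearMap_injective
    apply WithConv.toConv_injective
    rw [AlgHom.toLinearMap_convMul]
    exact algHom_self_conv_antipode ν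
  inv_val := by
    apply WithConv.ofConv_injective
    apply AlgHom.toLinearMap_injective
    apply WithConv.toConv_injective
    rw [AlgHom.toLinearMap_convMul]
    exact algHom_antipode_conv_self ν

lemma galoisEquiv_map_actL (μ : K →ₐ[k] k) (t : K ⊗[k] K) :
    galoisEquiv k K (TensorProduct.map (actL μ.toLinearMap) (actL μ.toLinearMap) t) =
      (actL μ.toLinearMap).rTensor K (galoisEquiv k K t) := by
  induction t using TensorProduct.induction_on with
  | zero => simp
  | add u v hu hv => simp only [map_add, hu, hv]
  | tmul x y =>
    rw [TensorProduct.map_tmul, galoisEquiv_tmul, galoisEquiv_tmul, comul_actL]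
    induction cop y using TensorProduct.induction_on with
    | zero => simp
    | add u v hu hv => simp only [mul_add, map_add, hu, hv]
    | tmul c d => simp [actL_mul]

variable [FiniteDimensional k K]

variable (k K) in
/-- The Galois map on the dual. -/
def dualGalois : Module.Dual k K ⊗[k] Module.Dual k K ≃ₗ[k] Module.Dual k K ⊗[k] Module.Dual k K :=
  TensorProduct.dualDistribEquiv k K K ≪≫ₗ
    ((TensorProduct.comm k K K) ≪≫ₗ (galoisEquiv k K).symm).dualMap ≪≫ₗ
    (TensorProduct.dualDistribEquiv k K K).symm

lemma actL_pow_finrank (ν : K →ₐ[k] k) : actL ν.toLinearMap ^ Module.finrank k K = 1 := by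
  have h := RepRank.pow_finrank_eq_one ((dualTranslation k K).comp (Units.coeHom _)) (charUnit ν)
    (v := Coalgebra.counit) ?_ (dualGalois k K) ?_
  · have h1 := congrArg (fun u => dualTranslation k K (Units.val u)) h
    simp only [Units.val_pow_eq_pow_val, Units.val_one, map_one, map_pow,
      Subspace.dual_finrank_eq] at h1
    have h2 : ∀ (j : ℕ) (f : Module.Dual k K), (dualTranslation k K (charUnit ν).1 ^ j) f =
        f ∘ₗ actL ν.toLinearMap ^ j := by
      intro j
      induction j with
      | zero => intro f; rfl
      | succ j ih => intro f; rw [pow_succ, Module.End.mul_apply, ih, pow_succ']; rfl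
    ext x
    rw [← sub_eq_zero, ← Module.forall_dual_apply_eq_zero_iff k]
    intro f
    rw [map_sub, sub_eq_zero]
    exact LinearMap.congr_fun ((h2 _ f).symm.trans (LinearMap.congr_fun h1 f)) x
  · have hinj : Function.Injective fun w : Subgroup.zpowers (charUnit ν) => w.1.1.ofConv :=
      WithConv.ofConv_injective.comp (Units.val_injective.comp Subtype.val_injective)
    have h := (linearIndependent_algHom_toLinearMap' k K k).comp _ hinj
    have e : (fun w : Subgroup.zpowers (charUnit ν) =>
        ((dualTranslation k K).comp (Units.coeHom _)) w.1 Coalgebra.counit) =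
        AlgHom.toLinearMap ∘ fun w : Subgroup.zpowers (charUnit ν) => w.1.1.ofConv := by
      ext1 w
      refine (apply_actL_eq_convMul _ _).trans ?_
      exact congrArg ofConv (mul_one (toConv w.1.1.ofConv.toLinearMap))
    rw [e]
    exact h
  · intro w a b
    simp only [dualGalois, LinearEquiv.trans_apply]
    rw [LinearEquiv.symm_apply_eq]
    have key : ∀ t : Module.Dual k K ⊗[k] Module.Dual k K,
      TensorProduct.dualDistribEquiv k K K
        ((((dualTranslation k K).comp (Units.coeHom _)) w).lTensor _ t) =
      TensorProduct.dualDistribEquiv k K K t ∘ₗ (actL w.1.ofConv.toLinearMap).lTensor K := by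
      intro t
      induction t using TensorProduct.induction_on with
      | zero => simp
      | add u v hu hv => simp only [map_add, hu, hv, LinearMap.add_comp]
      | tmul x y => ext; simp [dualTranslation_apply, TensorProduct.dualDistribEquiv]
    have key' : TensorProduct.dualDistribEquiv k K K
        ((((dualTranslation k K).comp (Units.coeHom _)) w) a ⊗ₜ
          (((dualTranslation k K).comp (Units.coeHom _)) w) b) =
        TensorProduct.dualDistribEquiv k K K (a ⊗ₜ b) ∘ₗ
          TensorProduct.map (actL w.1.ofConv.toLinearMap) (actL w.1.ofConv.toLinearMap) := by
      ext; simp [dualTranslation_apply, TensorProduct.dualDistribEquiv]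
    rw [key, LinearEquiv.apply_symm_apply, key']
    ext x y
    have h3 : TensorProduct.map (actL w.1.ofConv.toLinearMap) (actL w.1.ofConv.toLinearMap)
        ((galoisEquiv k K).symm (y ⊗ₜ x)) =
        (galoisEquiv k K).symm (actL w.1.ofConv.toLinearMap y ⊗ₜ x) := by
      rw [LinearEquiv.eq_symm_apply, galoisEquiv_map_actL, LinearEquiv.apply_symm_apply,
        LinearMap.rTensor_tmul]
    simp [LinearEquiv.dualMap_apply, h3]

end Galois

lemma conj_pow (a b : K) (j : ℕ) :
    (LinearMap.mulLeft k a * LinearMap.mulRight k b) ^ j =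
      LinearMap.mulLeft k (a ^ j) * LinearMap.mulRight k (b ^ j) := by
  have h : Commute (LinearMap.mulLeft k a) (LinearMap.mulRight k b) :=
    LinearMap.commute_mulLeft_right a b
  rw [h.mul_pow, LinearMap.pow_mulLeft,
    LinearMap.pow_mulRight]

/-- The antipode of a finite-dimensional Hopf algebra has order dividing four times the
dimension. -/
theorem antipode_pow_finrank [FiniteDimensional k K] :
    anti ^ (4 * Module.finrank k K) = 1 := by
  cases subsingleton_or_nontrivial K with
  | inl h => exact LinearMap.ext fun x => Subsingleton.elim _ _
  | inr h =>
    obtain ⟨g, ν, hg, hr⟩ := exists_radford (k := k) (K := K)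
    have hT := actL_pow_finrank ν
    have hT' := actR_pow_eq_one ν hT
    have h1 : anti ^ 4 * actR ν.toLinearMap =
        (LinearMap.mulLeft k g * LinearMap.mulRight k (anti g)) * actL ν.toLinearMap := by
      ext x
      simpa [pow_succ, mul_assoc] using hr x
    have h2 : Commute (anti ^ 4) (actR ν.toLinearMap) := by
      ext x
      simp [pow_succ, actR_antipode_antipode]
    have h3 : Commute (LinearMap.mulLeft k g * LinearMap.mulRight k (anti g))
        (actL ν.toLinearMap) := by
      ext x
      simpa [mul_assoc] using (actL_conj ν hg x).symm
    have h4 := h2.mul_pow (Module.finrank k K)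
    rw [h1, h3.mul_pow, hT, hT', mul_one, mul_one, conj_pow, groupLike_pow_finrank hg,
      groupLike_pow_finrank hg.antipode] at h4
    rw [pow_mul, ← h4]
    ext x
    simp

end FinHopf

namespace HopfGCoalgebra

section Pi

variable {k : Type*} [Field k] {G : Type*} {H : G → Type*}
  [∀ g, Ring (H g)] [∀ g, Algebra k (H g)]

lemma gcast_apply_pi (x : ∀ g, H g) {a b : G} (h : a = b) : gcast k H h (x a) = x b := by
  subst h; rfl

lemma mul'_map_apply (a : G) (f f' : Module.End k (∀ g, H g))
    (t : (∀ g, H g) ⊗[k] (∀ g, H g)) :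
    LinearMap.mul' k (∀ g, H g) (TensorProduct.map f f' t) a =
      LinearMap.mul' k (H a)
        (TensorProduct.map (LinearMap.proj a ∘ₗ f) (LinearMap.proj a ∘ₗ f') t) := by
  induction t using TensorProduct.induction_on with
  | zero => simp
  | add u v hu hv => simp only [map_add, Pi.add_apply, hu, hv]
  | tmul x y => simp

variable [Fintype G] [DecidableEq G]

lemma sum_single_proj : ∑ g, LinearMap.single k H g ∘ₗ LinearMap.proj g = LinearMap.id := by
  refine LinearMap.ext fun x => ?_
  simpa using! Finset.univ_sum_single x

lemma lTensor_ext_of_sum {ι M P : Type*} {Q : ι → Type*} [Fintype ι] [AddCommGroup M] [Module k M]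
    [AddCommGroup P] [Module k P] [∀ i, AddCommGroup (Q i)] [∀ i, Module k (Q i)]
    (p : ∀ i, P →ₗ[k] Q i) (s : ∀ i, Q i →ₗ[k] P) (h : ∑ i, s i ∘ₗ p i = LinearMap.id)
    {u v : M ⊗[k] P} (huv : ∀ i, (p i).lTensor M u = (p i).lTensor M v) : u = v := by
  have key : ∀ w : M ⊗[k] P, w = ∑ i, (s i).lTensor M ((p i).lTensor M w) := by
    intro w
    simp only [← LinearMap.lTensor_comp_apply, ← LinearMap.sum_apply]
    rw [← LinearMap.coe_lTensorHom, ← map_sum, h]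
    simp
  rw [key u, key v]
  exact Finset.sum_congr rfl fun i _ => by rw [huv]

lemma lTensor_pi_ext {M : Type*} [AddCommGroup M] [Module k M] {s t : M ⊗[k] (∀ g, H g)}
    (h : ∀ a, (LinearMap.proj (R := k) (φ := H) a).lTensor M s =
      (LinearMap.proj (R := k) (φ := H) a).lTensor M t) : s = t :=
  lTensor_ext_of_sum _ _ sum_single_proj h

lemma rTensor_pi_ext {M : Type*} [AddCommGroup M] [Module k M] {s t : (∀ g, H g) ⊗[k] M}
    (h : ∀ a, (LinearMap.proj (R := k) (φ := H) a).rTensor M s =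
      (LinearMap.proj (R := k) (φ := H) a).rTensor M t) : s = t := by
  have key : ∀ u : (∀ g, H g) ⊗[k] M, u = ∑ g, (LinearMap.single k H g).rTensor M
      ((LinearMap.proj (R := k) (φ := H) g).rTensor M u) := by
    intro u
    simp only [← LinearMap.rTensor_comp_apply, ← LinearMap.sum_apply]
    rw [← LinearMap.coe_rTensorHom, ← map_sum, sum_single_proj]
    simp
  rw [key s, key t]
  exact Finset.sum_congr rfl fun a _ => by rw [h]

lemma tensor_pi_ext {s t : (∀ g, H g) ⊗[k] (∀ g, H g)}
    (h : ∀ a b, TensorProduct.map (LinearMap.proj (R := k) (φ := H) a) (LinearMap.proj b) s =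
      TensorProduct.map (LinearMap.proj (R := k) (φ := H) a) (LinearMap.proj b) t) : s = t := by
  refine rTensor_pi_ext fun a => lTensor_pi_ext fun b => ?_
  simpa only [LinearMap.lTensor_comp_rTensor, ← LinearMap.comp_apply] using h a b

lemma sum_map_single_proj : ∑ i : G × G,
    TensorProduct.map (LinearMap.single k H i.1) (LinearMap.single k H i.2) ∘ₗ
      TensorProduct.map (LinearMap.proj i.1) (LinearMap.proj i.2) = LinearMap.id := by
  apply TensorProduct.ext'
  intro x y
  simp only [LinearMap.sum_apply, LinearMap.comp_apply, TensorProduct.map_tmul,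
    LinearMap.proj_apply, LinearMap.coe_single, Fintype.sum_prod_type, ← TensorProduct.tmul_sum,
    ← TensorProduct.sum_tmul, Finset.univ_sum_single, LinearMap.id_apply]

lemma tensor_tensor_pi_ext {s t : (∀ g, H g) ⊗[k] ((∀ g, H g) ⊗[k] (∀ g, H g))}
    (h : ∀ a b c, TensorProduct.map (LinearMap.proj (R := k) (φ := H) a)
      (TensorProduct.map (LinearMap.proj (R := k) (φ := H) b) (LinearMap.proj c)) s =
      TensorProduct.map (LinearMap.proj (R := k) (φ := H) a)
      (TensorProduct.map (LinearMap.proj (R := k) (φ := H) b) (LinearMap.proj c)) t) : s = t := by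
  refine rTensor_pi_ext fun a => lTensor_ext_of_sum _ _ sum_map_single_proj fun i => ?_
  simpa only [LinearMap.lTensor_comp_rTensor, ← LinearMap.comp_apply] using h a i.1 i.2

variable [Group G] [HopfGCoalgebra k H]

variable (k H) in
/-- The comultiplication on the product of the components of a finite family. -/
def piComul : (∀ g, H g) →ₗ[k] (∀ g, H g) ⊗[k] (∀ g, H g) :=
  ∑ a, ∑ b, TensorProduct.map (LinearMap.single k H a) (LinearMap.single k H b) ∘ₗ
    (HopfGCoalgebra.Δ a b).toLinearMap ∘ₗ LinearMap.proj (a * b)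

lemma map_proj_piComul (x : ∀ g, H g) (a b : G) :
    TensorProduct.map (LinearMap.proj (R := k) (φ := H) a) (LinearMap.proj b) (piComul k H x) =
      HopfGCoalgebra.Δ a b (x (a * b)) := by
  have h : ∀ c d : G, TensorProduct.map (LinearMap.proj (R := k) (φ := H) a) (LinearMap.proj b) ∘ₗ
      TensorProduct.map (LinearMap.single k H c) (LinearMap.single k H d) ∘ₗ
      (HopfGCoalgebra.Δ c d).toLinearMap ∘ₗ LinearMap.proj (c * d) =
      if c = a then if d = b then (HopfGCoalgebra.Δ a b).toLinearMap ∘ₗ LinearMap.proj (a * b)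
      else 0 else 0 := by
    intro c d
    rw [← LinearMap.comp_assoc, ← TensorProduct.map_comp]
    split_ifs with h1 h2
    · subst h1 h2
      rw [LinearMap.proj_comp_single_same, LinearMap.proj_comp_single_same, TensorProduct.map_id,
        LinearMap.id_comp]
    · rw [LinearMap.proj_comp_single_ne k H _ _ (Ne.symm h2)]
      simp
    · rw [LinearMap.proj_comp_single_ne k H _ _ (Ne.symm h1)]
      simp
  have h' : TensorProduct.map (LinearMap.proj (R := k) (φ := H) a) (LinearMap.proj b) ∘ₗ
      piComul k H = (HopfGCoalgebra.Δ a b).toLinearMap ∘ₗ LinearMap.proj (a * b) := by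
    refine LinearMap.ext fun y => ?_
    have hy : ∀ c d : G, TensorProduct.map (LinearMap.proj (R := k) (φ := H) a) (LinearMap.proj b)
        (TensorProduct.map (LinearMap.single k H c) (LinearMap.single k H d)
          (HopfGCoalgebra.Δ c d (y (c * d)))) =
        if c = a then if d = b then HopfGCoalgebra.Δ a b (y (a * b)) else 0 else 0 := fun c d => by
      refine (LinearMap.congr_fun (h c d) y).trans ?_
      split_ifs <;> rfl
    simp only [piComul, LinearMap.comp_apply, LinearMap.sum_apply, map_sum,
      AlgHom.toLinearMap_apply, LinearMap.proj_apply, hy]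
    simp
  exact LinearMap.congr_fun h' x

lemma map_piComul {M N : Type*} [AddCommGroup M] [Module k M] [AddCommGroup N] [Module k N]
    {a b : G} (f : H a →ₗ[k] M) (f' : H b →ₗ[k] N) (x : ∀ g, H g) :
    TensorProduct.map (f ∘ₗ LinearMap.proj a) (f' ∘ₗ LinearMap.proj b) (piComul k H x) =
      TensorProduct.map f f' (HopfGCoalgebra.Δ a b (x (a * b))) := by
  rw [TensorProduct.map_comp, LinearMap.comp_apply, map_proj_piComul]

variable (k H) in
/-- The counit on the product of the components. -/
def piCounit : (∀ g, H g) →ₐ[k] k := (HopfGCoalgebra.ε (k := k) (H := H)).comp (Pi.evalAlgHom k H 1)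

variable (k H) in
/-- The antipode on the product of the components. -/
def piAntipode : (∀ g, H g) →ₗ[k] ∀ g, H g :=
  LinearMap.pi fun a => ((gcast k H (inv_inv a)).toLinearMap ∘ₗ HopfGCoalgebra.S a⁻¹) ∘ₗ
    LinearMap.proj a⁻¹

variable (k H) in
/-- The comultiplication on the product as a morphism of algebras. -/
def piComulAlgHom : (∀ g, H g) →ₐ[k] (∀ g, H g) ⊗[k] (∀ g, H g) :=
  AlgHom.ofLinearMap (piComul k H)
    (tensor_pi_ext fun a b => by
      rw [map_proj_piComul, Pi.one_apply, map_one, Algebra.TensorProduct.one_def,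
        Algebra.TensorProduct.one_def]
      simp)
    (fun x y => tensor_pi_ext fun a b => by
      have h : ∀ s t : (∀ g, H g) ⊗[k] (∀ g, H g),
          TensorProduct.map (LinearMap.proj (R := k) (φ := H) a) (LinearMap.proj b) (s * t) =
          TensorProduct.map (LinearMap.proj (R := k) (φ := H) a) (LinearMap.proj b) s *
          TensorProduct.map (LinearMap.proj (R := k) (φ := H) a) (LinearMap.proj b) t :=
        map_mul (Algebra.TensorProduct.map (Pi.evalAlgHom k H a) (Pi.evalAlgHom k H b))
      rw [h, map_proj_piComul, map_proj_piComul, map_proj_piComul, Pi.mul_apply, map_mul])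

variable (k H) in
/-- The coalgebra structure on the product of the components. -/
abbrev piCoalgebra : Coalgebra k (∀ g, H g) where
  comul := piComul k H
  counit := (piCounit k H).toLinearMap
  coassoc := by
    refine LinearMap.ext fun x => tensor_tensor_pi_ext fun a b c => ?_
    have h := LinearMap.congr_fun (HopfGCoalgebra.coassoc (k := k) (H := H) a b c) (x (a * b * c))
    simp only [LinearMap.comp_apply, LinearEquiv.coe_coe, AlgEquiv.toLinearMap_apply,
      gcast_apply_pi, AlgHom.toLinearMap_apply] at h
    have hΔ : ∀ p q : G, TensorProduct.map (LinearMap.proj (R := k) (φ := H) p) (LinearMap.proj q)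
        ∘ₗ piComul k H = (HopfGCoalgebra.Δ p q).toLinearMap ∘ₗ LinearMap.proj (p * q) :=
      fun p q => LinearMap.ext fun y => map_proj_piComul y p q
    have h1 : ∀ w : ((∀ g, H g) ⊗[k] (∀ g, H g)) ⊗[k] (∀ g, H g),
        TensorProduct.map (LinearMap.proj (R := k) (φ := H) a)
          (TensorProduct.map (LinearMap.proj (R := k) (φ := H) b) (LinearMap.proj c))
          (TensorProduct.assoc k _ _ _ w) = TensorProduct.assoc k _ _ _
          (TensorProduct.map (TensorProduct.map (LinearMap.proj (R := k) (φ := H) a)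
            (LinearMap.proj b)) (LinearMap.proj c) w) := fun w => by
      rw [TensorProduct.map_map_assoc]
    rw [LinearMap.comp_apply, LinearMap.comp_apply, LinearEquiv.coe_coe, h1,
      ← LinearMap.comp_apply (TensorProduct.map _ _) (LinearMap.rTensor _ _),
      LinearMap.map_comp_rTensor, hΔ, LinearMap.comp_apply (LinearMap.lTensor _ _),
      ← LinearMap.comp_apply (TensorProduct.map _ _) (LinearMap.lTensor _ _),
      LinearMap.map_comp_lTensor, hΔ]
    have h2 := map_piComul (HopfGCoalgebra.Δ a b).toLinearMap (LinearMap.id : H c →ₗ[k] H c) x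
    have h3 := map_piComul (LinearMap.id : H a →ₗ[k] H a) (HopfGCoalgebra.Δ b c).toLinearMap x
    rw [LinearMap.id_comp] at h2 h3
    rw [h2, h3, h]
  rTensor_counit_comp_comul := by
    refine LinearMap.ext fun x => lTensor_pi_ext fun a => ?_
    have h := LinearMap.congr_fun (HopfGCoalgebra.counit_left (k := k) (H := H) a) (x a)
    apply (TensorProduct.lid k (H a)).injective
    have h2 := map_piComul (HopfGCoalgebra.ε (k := k) (H := H)).toLinearMap
      (LinearMap.id : H a →ₗ[k] H a) x
    simp only [LinearMap.comp_apply, LinearEquiv.coe_coe, AlgEquiv.toLinearMap_apply,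
      gcast_apply_pi, AlgHom.toLinearMap_apply] at h
    rw [← h2] at h
    rw [LinearMap.comp_apply, ← LinearMap.comp_apply (LinearMap.lTensor _ _),
      LinearMap.lTensor_comp_rTensor]
    refine h.trans ?_
    simp
  lTensor_counit_comp_comul := by
    refine LinearMap.ext fun x => rTensor_pi_ext fun a => ?_
    have h := LinearMap.congr_fun (HopfGCoalgebra.counit_right (k := k) (H := H) a) (x a)
    apply (TensorProduct.rid k (H a)).injective
    have h2 := map_piComul (LinearMap.id : H a →ₗ[k] H a)
      (HopfGCoalgebra.ε (k := k) (H := H)).toLinearMap x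
    simp only [LinearMap.comp_apply, LinearEquiv.coe_coe, AlgEquiv.toLinearMap_apply,
      gcast_apply_pi, AlgHom.toLinearMap_apply] at h
    rw [← h2] at h
    rw [LinearMap.comp_apply, ← LinearMap.comp_apply (LinearMap.rTensor _ _),
      LinearMap.rTensor_comp_lTensor]
    refine h.trans ?_
    simp

variable (k H) in
/-- The product of the components of a Hopf coalgebra over a finite group is a Hopf algebra. -/
abbrev piHopfAlgebra : HopfAlgebra k (∀ g, H g) :=
  letI := piCoalgebra k H
  { toBialgebra := Bialgebra.mk' k _ (map_one (piCounit k H)) (map_mul (piCounit k H) _ _)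
      (map_one (piComulAlgHom k H)) (map_mul (piComulAlgHom k H) _ _)
    antipode := piAntipode k H
    mul_antipode_rTensor_comul := by
      refine LinearMap.ext fun x => funext fun a => ?_
      have h := LinearMap.congr_fun (HopfGCoalgebra.antipode_left (k := k) (H := H) a)
        (x (a⁻¹ * a))
      have h2 := map_piComul ((gcast k H (inv_inv a)).toLinearMap ∘ₗ HopfGCoalgebra.S a⁻¹)
        (LinearMap.id : H a →ₗ[k] H a) x
      simp only [LinearMap.comp_apply, AlgEquiv.toLinearMap_apply,
        gcast_apply_pi, AlgHom.toLinearMap_apply] at h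
      rw [← h2] at h
      refine Eq.trans ?_ h
      exact mul'_map_apply a (piAntipode k H) LinearMap.id _
    mul_antipode_lTensor_comul := by
      refine LinearMap.ext fun x => funext fun a => ?_
      have h := LinearMap.congr_fun (HopfGCoalgebra.antipode_right (k := k) (H := H) a)
        (x (a * a⁻¹))
      have h2 := map_piComul (LinearMap.id : H a →ₗ[k] H a)
        ((gcast k H (inv_inv a)).toLinearMap ∘ₗ HopfGCoalgebra.S a⁻¹) x
      simp only [LinearMap.comp_apply, AlgEquiv.toLinearMap_apply,
        gcast_apply_pi, AlgHom.toLinearMap_apply] at h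
      rw [← h2] at h
      refine Eq.trans ?_ h
      exact mul'_map_apply a LinearMap.id (piAntipode k H) _ }

end Pi

section PiAntipode

variable {k : Type*} [Field k] {G : Type*} {H : G → Type*}
  [∀ g, Ring (H g)] [∀ g, Algebra k (H g)]

lemma pow_apply_component {f : Module.End k (∀ g, H g)} {a : G} {f' : Module.End k (H a)}
    (h : ∀ x, f x a = f' (x a)) (n : ℕ) (x : ∀ g, H g) : (f ^ n) x a = (f' ^ n) (x a) := by
  induction n with
  | zero => rfl
  | succ n ih => rw [pow_succ', pow_succ', Module.End.mul_apply, Module.End.mul_apply, h, ih]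

lemma pow_component_eq_one [DecidableEq G] {f : Module.End k (∀ g, H g)} {a : G} {f' : Module.End k (H a)}
    (h : ∀ x, f x a = f' (x a)) {n : ℕ} (hn : f ^ n = 1) : f' ^ n = 1 := by
  refine LinearMap.ext fun y => ?_
  have := pow_apply_component h n (Pi.single a y)
  rw [hn, Pi.single_eq_same] at this
  rw [← this]
  simp

variable [Group G] [HopfGCoalgebra k H]

lemma gcast_S_apply (x : ∀ g, H g) {a b : G} (h : a⁻¹ = b) (h' : a = b⁻¹) :
    gcast k H h (HopfGCoalgebra.S (k := k) a (x a)) =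
      gcast k H (inv_inv b) (HopfGCoalgebra.S (k := k) b⁻¹ (x b⁻¹)) := by
  subst h'; rfl

lemma piAntipode_apply (x : ∀ g, H g) (a : G) :
    piAntipode k H x a = gcast k H (inv_inv a) (HopfGCoalgebra.S (k := k) a⁻¹ (x a⁻¹)) := rfl

lemma piAntipode_sq_apply (x : ∀ g, H g) (a : G) :
    (piAntipode k H ^ 2) x a =
      ((gcast k H (inv_inv a)).toLinearMap ∘ₗ HopfGCoalgebra.S a⁻¹ ∘ₗ HopfGCoalgebra.S a) (x a) := by
  rw [pow_two, Module.End.mul_apply, piAntipode_apply, piAntipode_apply x,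
    ← gcast_S_apply (k := k) x (b := a⁻¹) rfl (inv_inv a).symm]
  rfl

variable [Fintype G] [DecidableEq G] [∀ g, FiniteDimensional k (H g)]

lemma piAntipode_pow_finrank : piAntipode k H ^ (4 * Module.finrank k (∀ g, H g)) = 1 :=
  let _ := piHopfAlgebra k H
  FinHopf.antipode_pow_finrank (k := k) (K := ∀ g, H g)

variable (k H) in
lemma finrank_mul_finrank_le (a b : G) :
    Module.finrank k (H a) * Module.finrank k (H (a * b)) ≤
      Module.finrank k (H a) * Module.finrank k (H b) := by
  let _ := piHopfAlgebra k H
  let p : ∀ c d : G, (∀ g, H g) ⊗[k] (∀ g, H g) →ₗ[k] H c ⊗[k] H d := fun c d =>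
    TensorProduct.map (LinearMap.proj (R := k) (φ := H) c) (LinearMap.proj d)
  let i : H a ⊗[k] H (a * b) →ₗ[k] (∀ g, H g) ⊗[k] (∀ g, H g) :=
    TensorProduct.map (LinearMap.single k H a) (LinearMap.single k H (a * b))
  have hi : Function.Injective i := by
    have : p a (a * b) ∘ₗ i = LinearMap.id := by
      rw [← TensorProduct.map_comp, LinearMap.proj_comp_single_same,
        LinearMap.proj_comp_single_same, TensorProduct.map_id]
    exact Function.LeftInverse.injective (g := p a (a * b)) fun x => LinearMap.congr_fun this x
  let Φ := FinHopf.galoisEquiv k (∀ g, H g)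
  have hp : ∀ c d (s t : (∀ g, H g) ⊗[k] (∀ g, H g)), p c d (s * t) = p c d s * p c d t :=
    fun c d => map_mul (Algebra.TensorProduct.map (Pi.evalAlgHom k H c) (Pi.evalAlgHom k H d))
  have hz : ∀ c d, (c, d) ≠ (a, b) → p c d ∘ₗ Φ.toLinearMap ∘ₗ i = 0 := by
    intro c d hcd
    refine TensorProduct.ext' fun x y => ?_
    have h1 : (p c d ∘ₗ Φ.toLinearMap ∘ₗ i) (x ⊗ₜ y) =
        p c d (Pi.single a x ⊗ₜ 1) * HopfGCoalgebra.Δ c d ((Pi.single (a * b) y : ∀ g, H g) (c * d)) := by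
      rw [← map_proj_piComul, ← hp]
      exact congrArg (p c d) (FinHopf.galoisEquiv_tmul (k := k) (Pi.single a x : ∀ g, H g) _)
    rw [h1, LinearMap.zero_apply]
    by_cases hc : c = a
    · subst hc
      have hd : c * d ≠ c * b := fun h => hcd (by rw [mul_left_cancel h])
      rw [Pi.single_eq_of_ne hd, map_zero, mul_zero]
    · have : p c d (Pi.single a x ⊗ₜ 1) = 0 := by
        change (Pi.single a x : ∀ g, H g) c ⊗ₜ[k] (1 : H d) = 0
        rw [Pi.single_eq_of_ne hc, TensorProduct.zero_tmul]
      rw [this, zero_mul]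
  have hinj : Function.Injective (p a b ∘ₗ Φ.toLinearMap ∘ₗ i) := by
    refine (injective_iff_map_eq_zero _).2 fun t ht => ?_
    refine (map_eq_zero_iff (Φ.toLinearMap ∘ₗ i) (Φ.injective.comp hi)).1 ?_
    refine tensor_pi_ext fun c d => ?_
    rw [map_zero]
    by_cases hcd : (c, d) = (a, b)
    · obtain ⟨rfl, rfl⟩ := Prod.mk.inj hcd
      exact ht
    · exact LinearMap.congr_fun (hz c d hcd) t
  simpa only [Module.finrank_tensorProduct] using LinearMap.finrank_le_finrank_of_injective hinj

lemma finrank_eq_of_generator {a : G} [Nontrivial (H a)] (ha : ∀ g, ∃ n : ℕ, a ^ n = g) (g : G) :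
    Module.finrank k (H g) = Module.finrank k (H 1) := by
  have hstep : ∀ b, Module.finrank k (H (a * b)) ≤ Module.finrank k (H b) := fun b =>
    Nat.le_of_mul_le_mul_left (finrank_mul_finrank_le k H a b) Module.finrank_pos
  have hle : ∀ (n : ℕ) b, Module.finrank k (H (a ^ n * b)) ≤ Module.finrank k (H b) := by
    intro n b
    induction n with
    | zero => rw [pow_zero, one_mul]
    | succ n ih =>
      rw [pow_succ', mul_assoc]
      exact (hstep _).trans ih
  apply le_antisymm
  · obtain ⟨n, hn⟩ := ha g
    have h := hle n 1
    rwa [hn, mul_one] at h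
  · obtain ⟨n, hn⟩ := ha g⁻¹
    have h := hle n g
    rwa [hn, inv_mul_cancel] at h

lemma piAntipode_pow_of_generator {a : G} [Nontrivial (H a)] (ha : ∀ g, ∃ n : ℕ, a ^ n = g) :
    piAntipode k H ^ (4 * (Nat.card G * Module.finrank k (H 1))) = 1 := by
  have h : Module.finrank k (∀ g, H g) = Nat.card G * Module.finrank k (H 1) := by
    rw [Module.finrank_pi_fintype, Finset.sum_congr rfl fun g _ => finrank_eq_of_generator ha g]
    simp
  rw [← h, piAntipode_pow_finrank]

end PiAntipode

section Restrict

variable {k : Type*} [Field k] {π : Type*} [Group π] {H : π → Type*}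
  [∀ g, Ring (H g)] [∀ g, Algebra k (H g)]

lemma gcast_subtype (P : Subgroup π) {a b : P} (h : a = b) (h' : (a : π) = b) :
    gcast k (fun g : P => H g) h = gcast k H h' := by
  subst h; rfl

variable (k H) in
/-- The restriction of a Hopf group-coalgebra to a subgroup of the index group. -/
abbrev restrict [HopfGCoalgebra k H] (P : Subgroup π) : HopfGCoalgebra k (fun g : P => H g) where
  Δ a b := HopfGCoalgebra.Δ (H := H) (a : π) b
  ε := HopfGCoalgebra.ε (H := H)
  S a := HopfGCoalgebra.S (H := H) (a : π)
  coassoc a b c := by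
    rw [gcast_subtype P _ (mul_assoc (a : π) b c)]
    exact HopfGCoalgebra.coassoc (H := H) (a : π) b c
  counit_right a := by
    rw [gcast_subtype P _ (mul_one (a : π)).symm]
    exact HopfGCoalgebra.counit_right (H := H) (a : π)
  counit_left a := by
    rw [gcast_subtype P _ (one_mul (a : π)).symm]
    exact HopfGCoalgebra.counit_left (H := H) (a : π)
  antipode_left a := by
    rw [gcast_subtype P _ (inv_inv (a : π)), gcast_subtype P _ (inv_mul_cancel (a : π))]
    exact HopfGCoalgebra.antipode_left (H := H) (a : π)
  antipode_right a := by
    rw [gcast_subtype P _ (inv_inv (a : π)), gcast_subtype P _ (mul_inv_cancel (a : π))]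
    exact HopfGCoalgebra.antipode_right (H := H) (a : π)

end Restrict

end HopfGCoalgebra

/-- Corollary 4.3: bounds on the order of (the square of) the antipode. If `α` has
finite order `d`, then `(S_{α⁻¹} ∘ S_α)^{2 d dim H₁} = id`; if `α` has order `2`,
then `S_α^{8 dim H₁} = id`. -/
theorem antipode_order_bound (k : Type*) [Field k] {π : Type*} [Group π]
    (H : π → Type*) [∀ α, Ring (H α)] [∀ α, Algebra k (H α)] [HopfGCoalgebra k H]
    [∀ α, FiniteDimensional k (H α)] (α : π) :
    (∀ d : ℕ, 0 < d → orderOf α = d →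
      ((gcast k H (inv_inv α)).toLinearMap ∘ₗ antipode k H α⁻¹ ∘ₗ antipode k H α)
          ^ (2 * d * Module.finrank k (H 1)) = LinearMap.id) ∧
    (∀ _h2 : orderOf α = 2,
      ((gcast k H (show α⁻¹ = α from inv_eq_of_mul_eq_one_right
            (by rw [← pow_two, ← _h2]; exact pow_orderOf_eq_one α))).toLinearMap ∘ₗ
          antipode k H α) ^ (8 * Module.finrank k (H 1)) = LinearMap.id) := by
  classical
  rcases subsingleton_or_nontrivial (H α) with hα | hα
  · exact ⟨fun _ _ _ => LinearMap.ext fun _ => Subsingleton.elim _ _,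
      fun _ => LinearMap.ext fun _ => Subsingleton.elim _ _⟩
  let _ := restrict k H (Subgroup.zpowers α)
  let a : Subgroup.zpowers α := ⟨α, Subgroup.mem_zpowers α⟩
  have : Nontrivial ((fun g : Subgroup.zpowers α => H g) a) := hα
  have key : ∀ d : ℕ, 0 < d → orderOf α = d →
      piAntipode k (fun g : Subgroup.zpowers α => H g) ^ (4 * (d * Module.finrank k (H 1))) = 1 := by
    rintro d hd rfl
    have hfin : IsOfFinOrder α := orderOf_pos_iff.1 hd
    have : Finite (Subgroup.zpowers α) := hfin.finite_zpowers
    have := Fintype.ofFinite (Subgroup.zpowers α)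
    rw [← Nat.card_zpowers]
    refine piAntipode_pow_of_generator (a := a) fun g => ?_
    obtain ⟨n, hn⟩ := hfin.mem_powers_iff_mem_zpowers.2 g.2
    exact ⟨n, Subtype.ext hn⟩
  constructor
  · intro d hd hα
    have h := key d hd hα
    rw [show 4 * (d * Module.finrank k (H 1)) = 2 * (2 * d * Module.finrank k (H 1)) by ring,
      pow_mul] at h
    refine pow_component_eq_one (H := fun g : Subgroup.zpowers α => H g) (a := a)
      (fun x => ?_) h
    rw [piAntipode_sq_apply, gcast_subtype _ _ (inv_inv α)]
    rfl
  · intro h2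
    have h := key 2 two_pos h2
    rw [show 4 * (2 * Module.finrank k (H 1)) = 8 * Module.finrank k (H 1) by ring] at h
    have hinv : α⁻¹ = α := inv_eq_of_mul_eq_one_right
      (by rw [← pow_two, ← h2]; exact pow_orderOf_eq_one α)
    have ha : a⁻¹ = a := Subtype.ext hinv
    refine pow_component_eq_one (H := fun g : Subgroup.zpowers α => H g) (a := a)
      (fun x => ?_) h
    rw [piAntipode_apply, ← gcast_S_apply (k := k) x ha ha.symm, gcast_subtype _ _ hinv]
    rfl
end
end

section
/- Let H be a finite dimensional Hopf π-coalgebra over a field k, let Λ be a left integral for the Hopf algebra H_1 (i.e., xΛ = ε(x)Λ for all x ∈ H_1), and let g = (g_α)_{α∈π} be the distinguished π-grouplike element of H. Then for every α ∈ π, writing Δ_{α,α⁻¹}(Λ) = Σ Λ_{(1,α)} ⊗ Λ_{(2,α⁻¹)} and Δ_{α⁻¹,α}(Λ) = Σ Λ_{(1,α⁻¹)} ⊗ Λ_{(2,α)}, one has Σ Λ_{(1,α)} ⊗ Λ_{(2,α⁻¹)} = Σ S_{α⁻¹}(S_α(Λ_{(2,α)}))·g_α ⊗ Λ_{(1,α⁻¹)}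 in H_α ⊗ H_{α⁻¹}. -/
open scoped TensorProduct

noncomputable section

open HopfGCoalgebra
open CrossedHopfGCoalgebra

open QTHopfGCoalgebra

theorem TensorProduct.ext_rid_map_dual {k V W : Type*} [Field k] [AddCommGroup V] [Module k V]
    [AddCommGroup W] [Module k W] [FiniteDimensional k W] {s t : V ⊗[k] W}
    (h : ∀ q : Module.Dual k W, TensorProduct.rid k V (TensorProduct.map LinearMap.id q s)
      = TensorProduct.rid k V (TensorProduct.map LinearMap.id q t)) : s = t := by
  let b := Module.finBasis k W
  have key : ∀ t : V ⊗[k] W,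
      ∑ i, TensorProduct.rid k V (TensorProduct.map LinearMap.id (b.coord i) t) ⊗ₜ[k] b i
        = t := by
    intro t
    induction t with
    | zero => simp
    | add s t hs ht => simp only [map_add, TensorProduct.add_tmul, Finset.sum_add_distrib, hs, ht]
    | tmul v w =>
      conv_rhs => rw [← b.sum_repr w, TensorProduct.tmul_sum]
      exact Finset.sum_congr rfl fun i _ ↦ by simp [TensorProduct.smul_tmul']
  rw [← key s, ← key t]
  simp only [h]

section PartialTrace

variable {k : Type*} [Field k] {U V W : Type*} [AddCommGroup U] [Module k U]
  [AddCommGroup V] [Module k V] [AddCommGroup W] [Module k W]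
  [FiniteDimensional k U] [FiniteDimensional k V]

/-- Tracing out the second factor of `(id ⊗ K) ∘ (G ⊗ id)`. -/
theorem trace_map_id_comp_assoc_comp_map (G : U →ₗ[k] U ⊗[k] W) (K : W ⊗[k] V →ₗ[k] V)
    (κ : W →ₗ[k] k)
    (hκ : ∀ w, LinearMap.trace k V (K ∘ₗ TensorProduct.mk k W V w) = κ w) :
    LinearMap.trace k (U ⊗[k] V)
        (TensorProduct.map LinearMap.id K ∘ₗ (TensorProduct.assoc k U W V).toLinearMap ∘ₗ
          TensorProduct.map G LinearMap.id)
      = LinearMap.trace k U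
          ((TensorProduct.rid k U).toLinearMap ∘ₗ TensorProduct.map LinearMap.id κ ∘ₗ G) := by
  obtain ⟨t, rfl⟩ := (dualTensorHomEquiv k U (U ⊗[k] W)).surjective G
  induction t with
  | zero => simp
  | add s t hs ht =>
    simp only [map_add, TensorProduct.map_add_left, LinearMap.comp_add, hs, ht]
  | tmul φ z =>
    induction z with
    | zero => simp
    | add s t hs ht =>
      simp only [TensorProduct.tmul_add, map_add, TensorProduct.map_add_left,
        LinearMap.comp_add, hs, ht]
    | tmul u w =>
      have h₁ : TensorProduct.map LinearMap.id K ∘ₗ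
          (TensorProduct.assoc k U W V).toLinearMap ∘ₗ
            TensorProduct.map (dualTensorHomEquiv k U (U ⊗[k] W) (φ ⊗ₜ (u ⊗ₜ w))) LinearMap.id
          = TensorProduct.map (φ.smulRight u) (K ∘ₗ TensorProduct.mk k W V w) := by
        ext a v
        simp [dualTensorHomEquiv, TensorProduct.smul_tmul']
      have h₂ : (TensorProduct.rid k U).toLinearMap ∘ₗ TensorProduct.map LinearMap.id κ ∘ₗ
            dualTensorHomEquiv k U (U ⊗[k] W) (φ ⊗ₜ (u ⊗ₜ w))
          = κ w • φ.smulRight u := by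
        ext a
        simp [dualTensorHomEquiv, smul_smul, mul_comm]
      rw [h₁, h₂, LinearMap.trace_tensorProduct', hκ, map_smul, smul_eq_mul, mul_comm]

end PartialTrace

theorem gcast_gcast {k : Type*} [CommSemiring k] {π : Type*} {H : π → Type*}
    [∀ α, Ring (H α)] [∀ α, Algebra k (H α)] {α β γ : π} (h : α = β) (h' : β = γ) (x : H α) :
    gcast k H h' (gcast k H h x) = gcast k H (h.trans h') x := by
  subst h h'; rfl

namespace HopfGCoalgebra

variable {k : Type*} [Field k] {π : Type*} [Group π] {H : π → Type*}
  [∀ α, Ring (H α)] [∀ α, Algebra k (H α)] [HopfGCoalgebra k H]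

section Structure

variable (k H) in
/-- The comultiplication `H γ → H α ⊗ H β` for any factorization `α * β = γ`. -/
def comulOf {α β γ : π} (h : α * β = γ) : H γ →ₐ[k] H α ⊗[k] H β :=
  (Δ α β).comp (gcast k H h.symm).toAlgHom

variable (k H) in
/-- The antipode `H α → H β` for any `β` inverse to `α`. -/
def antipodeOf {α β : π} (h : α * β = 1) : H α →ₗ[k] H β :=
  (gcast k H (inv_eq_of_mul_eq_one_right h)).toLinearMap ∘ₗ S α

theorem comulOf_coassoc {α β γ δ η ζ : π} (h₁ : α * β = δ) (h₂ : δ * γ = ζ) (h₃ : β * γ = η)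
    (h₄ : α * η = ζ) (x : H ζ) :
    TensorProduct.assoc k (H α) (H β) (H γ)
        (TensorProduct.map (comulOf k H h₁).toLinearMap LinearMap.id (comulOf k H h₂ x))
      = TensorProduct.map LinearMap.id (comulOf k H h₃).toLinearMap (comulOf k H h₄ x) := by
  subst h₁ h₂ h₃
  exact LinearMap.congr_fun (coassoc (k := k) (H := H) α β γ) x

theorem rid_map_counit_comulOf {α : π} (h : α * 1 = α) (x : H α) :
    TensorProduct.rid k (H α)
      (TensorProduct.map LinearMap.id (counit k H).toLinearMap (comulOf k H h x)) = x :=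
  LinearMap.congr_fun (counit_right (k := k) (H := H) α) x

theorem lid_map_counit_comulOf {α : π} (h : 1 * α = α) (x : H α) :
    TensorProduct.lid k (H α)
      (TensorProduct.map (counit k H).toLinearMap LinearMap.id (comulOf k H h x)) = x :=
  LinearMap.congr_fun (counit_left (k := k) (H := H) α) x

theorem mul_antipodeOf_left {α β : π} (h : α * β = 1) (x : H 1) :
    LinearMap.mul' k (H β)
        (TensorProduct.map (antipodeOf k H h) LinearMap.id (comulOf k H h x))
      = algebraMap k (H β) (counit k H x) := by
  obtain rfl : α = β⁻¹ := eq_inv_of_mul_eq_one_left h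
  have := LinearMap.congr_fun (antipode_left (k := k) (H := H) β) (gcast k H h.symm x)
  simp only [LinearMap.comp_apply, AlgEquiv.toLinearMap_apply, gcast_gcast] at this
  exact this

theorem mul_antipodeOf_right {α β : π} (h : α * β = 1) (h' : β * α = 1) (x : H 1) :
    LinearMap.mul' k (H α)
        (TensorProduct.map LinearMap.id (antipodeOf k H h') (comulOf k H h x))
      = algebraMap k (H α) (counit k H x) := by
  obtain rfl : β = α⁻¹ := eq_inv_of_mul_eq_one_right h
  have := LinearMap.congr_fun (antipode_right (k := k) (H := H) α) (gcast k H h.symm x)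
  simp only [LinearMap.comp_apply, AlgEquiv.toLinearMap_apply, gcast_gcast] at this
  exact this

end Structure

section Convolution

variable {R : Type*} [Ring R] [Algebra k R]

/-- The convolution product of linear maps out of the components of `H`. -/
def conv {α β γ : π} (h : α * β = γ) (P : H α →ₗ[k] R) (Q : H β →ₗ[k] R) : H γ →ₗ[k] R :=
  LinearMap.mul' k R ∘ₗ TensorProduct.map P Q ∘ₗ (comulOf k H h).toLinearMap

theorem conv_apply {α β γ : π} (h : α * β = γ) (P : H α →ₗ[k] R) (Q : H β →ₗ[k] R) (x : H γ) :
    conv h P Q x = LinearMap.mul' k R (TensorProduct.map P Q (comulOf k H h x)) := rfl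

variable (k H R) in
/-- The neutral element of the convolution product. -/
def convOne : H (1 : π) →ₗ[k] R := Algebra.linearMap k R ∘ₗ (counit k H).toLinearMap

theorem conv_assoc {α β γ δ η ζ : π} (h₁ : α * β = δ) (h₂ : δ * γ = ζ) (h₃ : β * γ = η)
    (h₄ : α * η = ζ) (P : H α →ₗ[k] R) (Q : H β →ₗ[k] R) (T : H γ →ₗ[k] R) :
    conv h₂ (conv h₁ P Q) T = conv h₄ P (conv h₃ Q T) := by
  have hl : ∀ t : H δ ⊗[k] H γ, LinearMap.mul' k R (TensorProduct.map (conv h₁ P Q) T t)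
      = LinearMap.mul' k R (TensorProduct.map P (LinearMap.mul' k R ∘ₗ TensorProduct.map Q T)
          (TensorProduct.assoc k _ _ _
            (TensorProduct.map (comulOf k H h₁).toLinearMap LinearMap.id t))) := by
    intro t
    induction t with
    | zero => simp
    | add s t hs ht => simp only [map_add, hs, ht]
    | tmul a c =>
      simp only [TensorProduct.map_tmul, conv_apply, LinearMap.mul'_apply,
        AlgHom.toLinearMap_apply, LinearMap.id_apply]
      induction comulOf k H h₁ a with
      | zero => simp
      | add s t hs ht => simp only [map_add, add_mul, TensorProduct.add_tmul, hs, ht]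
      | tmul a b => simp [mul_assoc]
  ext x
  rw [conv_apply, hl, comulOf_coassoc h₁ h₂ h₃ h₄, conv_apply,
    ← LinearMap.comp_apply (TensorProduct.map _ _), ← TensorProduct.map_comp]
  rfl

theorem conv_convOne {α : π} (h : α * 1 = α) (P : H α →ₗ[k] R) :
    conv h P (convOne k H R) = P := by
  ext x
  conv_rhs => rw [← rid_map_counit_comulOf (k := k) h x]
  rw [conv_apply]
  induction comulOf k H h x with
  | zero => simp
  | add s t hs ht => simp only [map_add, hs, ht]
  | tmul a b => simp [convOne, Algebra.algebraMap_eq_smul_one]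

theorem convOne_conv {α : π} (h : 1 * α = α) (P : H α →ₗ[k] R) :
    conv h (convOne k H R) P = P := by
  ext x
  conv_rhs => rw [← lid_map_counit_comulOf (k := k) h x]
  rw [conv_apply]
  induction comulOf k H h x with
  | zero => simp
  | add s t hs ht => simp only [map_add, hs, ht]
  | tmul a b => simp [convOne, Algebra.algebraMap_eq_smul_one]

theorem algHom_comp_conv {R' : Type*} [Ring R'] [Algebra k R'] (F : R →ₐ[k] R') {α β γ : π}
    (h : α * β = γ) (P : H α →ₗ[k] R) (Q : H β →ₗ[k] R) :
    F.toLinearMap ∘ₗ conv h P Q = conv h (F.toLinearMap ∘ₗ P) (F.toLinearMap ∘ₗ Q) := by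
  ext x
  simp only [LinearMap.comp_apply, conv_apply]
  induction comulOf k H h x with
  | zero => simp
  | add s t hs ht => simp only [map_add, hs, ht]
  | tmul a b => simp

theorem mulRight_comp_conv (r : R) {α β γ : π} (h : α * β = γ) (P : H α →ₗ[k] R)
    (Q : H β →ₗ[k] R) :
    LinearMap.mulRight k r ∘ₗ conv h P Q = conv h P (LinearMap.mulRight k r ∘ₗ Q) := by
  ext x
  simp only [LinearMap.comp_apply, conv_apply]
  induction comulOf k H h x with
  | zero => simp
  | add s t hs ht => simp only [map_add, hs, ht]
  | tmul a b => simp [mul_assoc]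

theorem algHom_comp_convOne {R' : Type*} [Ring R'] [Algebra k R'] (F : R →ₐ[k] R') :
    F.toLinearMap ∘ₗ convOne k H R = convOne k H R' := by
  ext x; simp [convOne]

theorem conv_antipodeOf_left {α β : π} (h : α * β = 1) (F : H β →ₐ[k] R) :
    conv h (F.toLinearMap ∘ₗ antipodeOf k H h) F.toLinearMap = convOne k H R := by
  rw [← algHom_comp_convOne F, ← LinearMap.comp_id F.toLinearMap, LinearMap.comp_assoc,
    LinearMap.id_comp, ← algHom_comp_conv]
  congr 1
  ext x
  exact mul_antipodeOf_left h x

theorem conv_antipodeOf_right {α β : π} (h : α * β = 1) (h' : β * α = 1) (F : H α →ₐ[k] R) :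
    conv h F.toLinearMap (F.toLinearMap ∘ₗ antipodeOf k H h') = convOne k H R := by
  rw [← algHom_comp_convOne F]
  nth_rw 1 [← LinearMap.comp_id F.toLinearMap]
  rw [← algHom_comp_conv]
  congr 1
  ext x
  exact mul_antipodeOf_right h h' x

end Convolution

section AntipodeIdentities

open Algebra.TensorProduct (includeLeft includeRight)

theorem comulOf_eq_conv {α β γ : π} (h : α * β = γ) :
    (comulOf k H h).toLinearMap
      = conv h (includeLeft : H α →ₐ[k] H α ⊗[k] H β).toLinearMap
          (includeRight : H β →ₐ[k] H α ⊗[k] H β).toLinearMap := by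
  ext x
  rw [conv_apply, AlgHom.toLinearMap_apply]
  induction comulOf k H h x with
  | zero => simp
  | add s t hs ht =>
    nth_rw 1 [hs, ht]
    simp only [map_add]
  | tmul a b => simp

/-- `Σ (S(x₁) ⊗ 1) Δ(x₂) = 1 ⊗ x`. -/
theorem conv_includeLeft_antipodeOf_comulOf {α α' γ δ : π} (h : α * α' = 1) (hδ : α' * γ = δ)
    (hγ : α * δ = γ) :
    conv hγ ((includeLeft : H α' →ₐ[k] H α' ⊗[k] H γ).toLinearMap ∘ₗ antipodeOf k H h)
        (comulOf k H hδ).toLinearMap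
      = (includeRight : H γ →ₐ[k] H α' ⊗[k] H γ).toLinearMap := by
  rw [comulOf_eq_conv, ← conv_assoc h (one_mul γ), conv_antipodeOf_left, convOne_conv]

/-- `Σ (1 ⊗ y₁) Δ(S(y₂)) = S(y) ⊗ 1`. -/
theorem conv_includeRight_comulOf_antipodeOf {α β ρ γ δ : π} (hρ : α * β = ρ) (hδ : δ * ρ = 1)
    (hγ : γ * α = 1) (h : β * δ = γ) :
    conv h (includeRight : H β →ₐ[k] H α ⊗[k] H β).toLinearMap
        ((comulOf k H hρ).toLinearMap ∘ₗ antipodeOf k H hδ)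
      = (includeLeft : H α →ₐ[k] H α ⊗[k] H β).toLinearMap ∘ₗ antipodeOf k H hγ := by
  have hβ : γ * ρ = β := by rw [← hρ, ← mul_assoc, hγ, one_mul]
  have hδ' : ρ * δ = 1 := mul_eq_one_comm.mp hδ
  rw [← conv_includeLeft_antipodeOf_comulOf hγ hρ hβ, conv_assoc hβ h hδ' (mul_one γ),
    conv_antipodeOf_right, conv_convOne]

theorem comulOf_antipodeOf_eq_conv {α β ρ γ β' δ : π} (hρ : α * β = ρ) (hδ : δ * ρ = 1)
    (hγ : γ * α = 1) (hβ : β' * β = 1) (h : β' * γ = δ) :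
    (comulOf k H hρ).toLinearMap ∘ₗ antipodeOf k H hδ
      = conv h ((includeRight : H β →ₐ[k] H α ⊗[k] H β).toLinearMap ∘ₗ antipodeOf k H hβ)
          ((includeLeft : H α →ₐ[k] H α ⊗[k] H β).toLinearMap ∘ₗ antipodeOf k H hγ) := by
  have h' : β * δ = γ := by rw [← h, ← mul_assoc, mul_eq_one_comm.mp hβ, one_mul]
  rw [← conv_includeRight_comulOf_antipodeOf hρ hδ hγ h', ← conv_assoc hβ (one_mul δ),
    conv_antipodeOf_left, convOne_conv]

/-- The antipode reverses the comultiplication. -/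
theorem comulOf_antipodeOf {α β ρ γ β' δ : π} (hρ : α * β = ρ) (hδ : δ * ρ = 1)
    (hγ : γ * α = 1) (hβ : β' * β = 1) (h : β' * γ = δ) (y : H δ) :
    comulOf k H hρ (antipodeOf k H hδ y)
      = TensorProduct.comm k (H β) (H α)
          (TensorProduct.map (antipodeOf k H hβ) (antipodeOf k H hγ) (comulOf k H h y)) := by
  refine (LinearMap.congr_fun (comulOf_antipodeOf_eq_conv hρ hδ hγ hβ h) y).trans ?_
  rw [conv_apply]
  induction comulOf k H h y with
  | zero => simp
  | add s t hs ht => simp only [map_add, hs, ht]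
  | tmul a b => simp

/-- `S²(y) ⊗ 1 = Σ (1 ⊗ S(y₂)) Δ(S²(y₁))`. -/
theorem includeLeft_antipodeOf_antipodeOf {α β ρ γ β' δ : π} (hρ : α * β = ρ) (hδ : δ * ρ = 1)
    (hδ' : ρ * δ = 1) (hγ : γ * α = 1) (hγ' : α * γ = 1) (hβ : β' * β = 1) (h : ρ * β' = α)
    (y : H α) :
    (includeLeft : H α →ₐ[k] H α ⊗[k] H β) (antipodeOf k H hγ (antipodeOf k H hγ' y))
      = LinearMap.mul' k (H α ⊗[k] H β)
          (TensorProduct.map (includeRight : H β →ₐ[k] H α ⊗[k] H β).toLinearMap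
            ((comulOf k H hρ).toLinearMap ∘ₗ antipodeOf k H hδ)
            (TensorProduct.comm k (H δ) (H β)
              (TensorProduct.map (antipodeOf k H hδ') (antipodeOf k H hβ)
                (comulOf k H h y)))) := by
  have hγβ : β * δ = γ := by
    rw [eq_inv_of_mul_eq_one_left hδ, eq_inv_of_mul_eq_one_left hγ, ← hρ]; group
  rw [← comulOf_antipodeOf hγβ hγ' hβ hδ' h y]
  exact (LinearMap.congr_fun (conv_includeRight_comulOf_antipodeOf hρ hδ hγ hγβ) _).symm

theorem counit_antipodeOf (h : (1 : π) * 1 = 1) (x : H 1) :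
    counit k H (antipodeOf k H h x) = counit k H x := by
  have h₁ : (counit k H).toLinearMap = convOne k H k := by ext; simp [convOne]
  have h₂ := conv_antipodeOf_left h (counit k H)
  rw [h₁, conv_convOne, ← h₁] at h₂
  exact LinearMap.congr_fun h₂ x

/-- `(S(x) ⊗ 1) Δ(Λ) = (1 ⊗ x) Δ(Λ)` for a left integral `Λ` of `H 1`. -/
theorem includeLeft_antipodeOf_mul_comulOf {Λ : H (1 : π)}
    (hΛ : ∀ x : H (1 : π), x * Λ = counit k H x • Λ) {α β : π} (h : α * β = 1) (h' : β * α = 1)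
    (x : H α) :
    (includeLeft : H β →ₐ[k] H β ⊗[k] H α) (antipodeOf k H h x) * comulOf k H h' Λ
      = (includeRight : H α →ₐ[k] H β ⊗[k] H α) x * comulOf k H h' Λ := by
  have h₁ := conv_includeLeft_antipodeOf_comulOf (k := k) (H := H) h h' (mul_one α)
  have h₂ : LinearMap.mulRight k (comulOf k H h' Λ) ∘ₗ (comulOf k H h').toLinearMap
      = LinearMap.mulRight k (comulOf k H h' Λ) ∘ₗ convOne k H (H β ⊗[k] H α) := by
    ext y
    simp [convOne, ← map_mul, hΛ, Algebra.algebraMap_eq_smul_one]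
  have h₃ := congrArg (LinearMap.mulRight k (comulOf k H h' Λ) ∘ₗ ·) h₁
  simp only [mulRight_comp_conv, h₂] at h₃
  rw [← mulRight_comp_conv, conv_convOne] at h₃
  exact LinearMap.congr_fun h₃ x

end AntipodeIdentities

section TraceIntegral

open Algebra.TensorProduct (includeLeft includeRight)

/-- The right action of `f ∈ H₁*` on `H α` as a linear map. -/
def hitRLinear (f : H (1 : π) →ₗ[k] k) (α : π) : H α →ₗ[k] H α :=
  (TensorProduct.lid k (H α)).toLinearMap ∘ₗ TensorProduct.map f LinearMap.id ∘ₗ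
    (comulOf k H (one_mul α)).toLinearMap

theorem comulOf_hitRLinear (f : H (1 : π) →ₗ[k] k) {α β γ : π} (h : α * β = γ) (z : H γ) :
    comulOf k H h (hitRLinear f γ z)
      = TensorProduct.map (hitRLinear f α) LinearMap.id (comulOf k H h z) := by
  have h₁ : ∀ t : H 1 ⊗[k] H γ,
      comulOf k H h (TensorProduct.lid k _ (TensorProduct.map f LinearMap.id t))
        = TensorProduct.lid k _ (TensorProduct.map f LinearMap.id
            (TensorProduct.map LinearMap.id (comulOf k H h).toLinearMap t)) := by
    intro t
    induction t with
    | zero => simp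
    | add s t hs ht => simp only [map_add, hs, ht]
    | tmul a b => simp
  have h₂ : ∀ t : H α ⊗[k] H β,
      TensorProduct.lid k _ (TensorProduct.map f LinearMap.id
          (TensorProduct.assoc k _ _ _
            (TensorProduct.map (comulOf k H (one_mul α)).toLinearMap LinearMap.id t)))
        = TensorProduct.map (hitRLinear f α) LinearMap.id t := by
    intro t
    induction t with
    | zero => simp
    | add s t hs ht => simp only [map_add, hs, ht]
    | tmul a b =>
      simp only [TensorProduct.map_tmul, hitRLinear, LinearMap.comp_apply,
        AlgHom.toLinearMap_apply, LinearMap.id_apply, LinearEquiv.coe_coe]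
      induction comulOf k H (one_mul α) a with
      | zero => simp
      | add s t hs ht => simp only [map_add, TensorProduct.add_tmul, hs, ht]
      | tmul a b => simp [TensorProduct.smul_tmul']
  rw [← h₂, comulOf_coassoc (one_mul α) h h (one_mul γ)]
  exact h₁ _

theorem counit_hitRLinear (f : H (1 : π) →ₗ[k] k) (x : H 1) :
    counit k H (hitRLinear f 1 x) = f x := by
  conv_rhs => rw [← rid_map_counit_comulOf (k := k) (one_mul 1) x]
  simp only [hitRLinear, LinearMap.comp_apply, AlgHom.toLinearMap_apply, LinearEquiv.coe_coe]
  induction comulOf k H (one_mul 1) x with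
  | zero => simp
  | add s t hs ht => simp only [map_add, hs, ht]
  | tmul a b => simp [mul_comm]

variable (k H) in
/-- The square of the antipode on `H α`. -/
def sqAntipode (α : π) : H α →ₗ[k] H α :=
  antipodeOf k H (inv_mul_cancel α) ∘ₗ antipodeOf k H (mul_inv_cancel α)

theorem antipodeOf_antipodeOf {α β : π} (h : α * β = 1) (h' : β * α = 1) (x : H α) :
    antipodeOf k H h' (antipodeOf k H h x) = sqAntipode k H α x := by
  obtain rfl : β = α⁻¹ := eq_inv_of_mul_eq_one_right h
  rfl

/-- The family of forms `x ↦ Tr (y ↦ (S²(y) x) ↼ f)`. -/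
def traceIntegral (f : H (1 : π) →ₗ[k] k) (α : π) : H α →ₗ[k] k where
  toFun x := LinearMap.trace k (H α)
    (hitRLinear f α ∘ₗ LinearMap.mulRight k x ∘ₗ sqAntipode k H α)
  map_add' x y := by
    rw [← map_add]; congr 1; ext z; simp [mul_add]
  map_smul' c x := by
    rw [RingHom.id_apply, ← map_smul]; congr 1; ext z; simp

theorem traceIntegral_apply (f : H (1 : π) →ₗ[k] k) (α : π) (x : H α) :
    traceIntegral f α x = LinearMap.trace k (H α)
      (hitRLinear f α ∘ₗ LinearMap.mulRight k x ∘ₗ sqAntipode k H α) := rfl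

theorem apply_lid_map_traceIntegral (f : H (1 : π) →ₗ[k] k) {α β : π} (p : H β →ₗ[k] k)
    (w : H α ⊗[k] H β) :
    p (TensorProduct.lid k (H β) (TensorProduct.map (traceIntegral f α) LinearMap.id w))
      = LinearMap.trace k (H α) ((TensorProduct.rid k (H α)).toLinearMap ∘ₗ
          TensorProduct.map (hitRLinear f α) p ∘ₗ LinearMap.mulRight k w ∘ₗ
            (includeLeft : H α →ₐ[k] H α ⊗[k] H β).toLinearMap ∘ₗ sqAntipode k H α) := by
  induction w with
  | zero =>
    have : LinearMap.mulRight k (0 : H α ⊗[k] H β) = 0 := by ext; simp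
    simp [this]
  | add s t hs ht =>
    have : LinearMap.mulRight k (s + t) = LinearMap.mulRight k s + LinearMap.mulRight k t :=
      LinearMap.ext fun z ↦ mul_add z s t
    simp only [map_add, hs, ht, this, LinearMap.add_comp, LinearMap.comp_add]
  | tmul a b =>
    have : (TensorProduct.rid k (H α)).toLinearMap ∘ₗ
          TensorProduct.map (hitRLinear f α) p ∘ₗ LinearMap.mulRight k (a ⊗ₜ[k] b) ∘ₗ
            (includeLeft : H α →ₐ[k] H α ⊗[k] H β).toLinearMap ∘ₗ sqAntipode k H α
        = p b • (hitRLinear f α ∘ₗ LinearMap.mulRight k a ∘ₗ sqAntipode k H α) := by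
      ext y
      simp
    rw [this, map_smul, ← traceIntegral_apply]
    simp [mul_comm]

/-- `c ⊗ v ↦ Σ c₁ p(S(v) c₂)`. -/
def antipodeContraction {β β' : π} (h : β' * β = 1) (p : H β →ₗ[k] k) :
    H (1 : π) ⊗[k] H β' →ₗ[k] H β' :=
  (TensorProduct.rid k (H β')).toLinearMap ∘ₗ TensorProduct.map LinearMap.id p ∘ₗ
    LinearMap.mul' k (H β' ⊗[k] H β) ∘ₗ
    TensorProduct.map
      ((includeRight : H β →ₐ[k] H β' ⊗[k] H β).toLinearMap ∘ₗ antipodeOf k H h)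
      (comulOf k H h).toLinearMap ∘ₗ (TensorProduct.comm k (H 1) (H β')).toLinearMap

theorem antipodeContraction_tmul {β β' : π} (h : β' * β = 1) (p : H β →ₗ[k] k) (c : H (1 : π))
    (v : H β') :
    antipodeContraction h p (c ⊗ₜ v)
      = TensorProduct.rid k (H β') (TensorProduct.map LinearMap.id p
          ((1 ⊗ₜ antipodeOf k H h v) * comulOf k H h c)) := by
  simp [antipodeContraction]

theorem comulOf_rid_map_hitRLinear (f : H (1 : π) →ₗ[k] k) {α β ρ β' : π} (hρ : α * β = ρ)
    (hβ : β' * β = 1) (h : ρ * β' = α) (p : H β →ₗ[k] k) (w : H ρ) (v : H β') :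
    comulOf k H h (TensorProduct.rid k (H α) (TensorProduct.map (hitRLinear f α) p
        ((1 ⊗ₜ antipodeOf k H hβ v) * comulOf k H hρ w)))
      = TensorProduct.map LinearMap.id (antipodeContraction hβ p)
          (TensorProduct.assoc k _ _ _
            (TensorProduct.map (hitRLinear f ρ) LinearMap.id (comulOf k H (mul_one ρ) w)
              ⊗ₜ v)) := by
  set s := antipodeOf k H hβ v with hs
  let E : H β' ⊗[k] H β →ₗ[k] H β' := (TensorProduct.rid k (H β')).toLinearMap ∘ₗ
    TensorProduct.map LinearMap.id p ∘ₗ LinearMap.mulLeft k (1 ⊗ₜ[k] s)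
  have h₁ : ∀ t : H α ⊗[k] H β,
      comulOf k H h (TensorProduct.rid k (H α) (TensorProduct.map (hitRLinear f α) p
          ((1 ⊗ₜ s) * t)))
        = TensorProduct.map (hitRLinear f ρ) E (TensorProduct.assoc k _ _ _
            (TensorProduct.map (comulOf k H h).toLinearMap LinearMap.id t)) := by
    intro t
    induction t with
    | zero => simp
    | add s t hs ht => simp only [map_add, mul_add, hs, ht]
    | tmul a b =>
      simp only [Algebra.TensorProduct.tmul_mul_tmul, one_mul, TensorProduct.map_tmul,
        TensorProduct.rid_tmul, map_smul, comulOf_hitRLinear, AlgHom.toLinearMap_apply,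
        LinearMap.id_apply]
      induction comulOf k H h a with
      | zero => simp
      | add s t hs ht => simp only [map_add, TensorProduct.add_tmul, smul_add, hs, ht]
      | tmul a b => simp [E]
  have h₂ : ∀ t : H ρ ⊗[k] H 1,
      TensorProduct.map (hitRLinear f ρ) E
          (TensorProduct.map LinearMap.id (comulOf k H hβ).toLinearMap t)
        = TensorProduct.map LinearMap.id (antipodeContraction hβ p)
          (TensorProduct.assoc k _ _ _
            (TensorProduct.map (hitRLinear f ρ) LinearMap.id t ⊗ₜ v)) := by
    intro t
    induction t with
    | zero => simp
    | add s t hs ht => simp only [map_add, TensorProduct.add_tmul, hs, ht]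
    | tmul a b => simp [antipodeContraction_tmul, E, hs]
  rw [h₁, comulOf_coassoc h hρ hβ (mul_one ρ), h₂]

variable [∀ α, FiniteDimensional k (H α)]

theorem traceIntegral_leftIntegral (f : H (1 : π) →ₗ[k] k) {Λ : H (1 : π)}
    (hΛ : ∀ x : H (1 : π), x * Λ = counit k H x • Λ) : traceIntegral f 1 Λ = f Λ := by
  have hε : ∀ x : H (1 : π), counit k H (sqAntipode k H 1 x) = counit k H x := fun x ↦ by
    rw [← antipodeOf_antipodeOf (one_mul 1) (one_mul 1), counit_antipodeOf, counit_antipodeOf]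
  have h : hitRLinear f 1 ∘ₗ LinearMap.mulRight k Λ ∘ₗ sqAntipode k H 1
      = (counit k H).toLinearMap.smulRight (hitRLinear f 1 Λ) := by
    ext x
    simp [hΛ, hε]
  rw [traceIntegral_apply, h, LinearMap.trace_smulRight]
  exact counit_hitRLinear f Λ

theorem trace_antipodeContraction {β β' : π} (h : β' * β = 1) (p : H β →ₗ[k] k)
    (c : H (1 : π)) :
    LinearMap.trace k (H β') (antipodeContraction h p ∘ₗ TensorProduct.mk k _ _ c)
      = (p 1 • (counit k H).toLinearMap) c := by
  have key : ∀ z : H β' ⊗[k] H β,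
      LinearMap.trace k (H β') ((TensorProduct.rid k (H β')).toLinearMap ∘ₗ
          TensorProduct.map LinearMap.id p ∘ₗ LinearMap.mulRight k z ∘ₗ
          (includeRight : H β →ₐ[k] H β' ⊗[k] H β).toLinearMap ∘ₗ antipodeOf k H h)
        = p (LinearMap.mul' k (H β)
            (TensorProduct.map (antipodeOf k H h) LinearMap.id z)) := by
    intro z
    induction z with
    | zero =>
      have : LinearMap.mulRight k (0 : H β' ⊗[k] H β) = 0 := by ext; simp
      simp [this]
    | add s t hs ht =>
      have : LinearMap.mulRight k (s + t) = LinearMap.mulRight k s + LinearMap.mulRight k t :=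
        LinearMap.ext fun z ↦ mul_add z s t
      simp only [map_add, hs, ht, this, LinearMap.add_comp, LinearMap.comp_add]
    | tmul a b =>
      have : (TensorProduct.rid k (H β')).toLinearMap ∘ₗ
            TensorProduct.map LinearMap.id p ∘ₗ LinearMap.mulRight k (a ⊗ₜ[k] b) ∘ₗ
            (includeRight : H β →ₐ[k] H β' ⊗[k] H β).toLinearMap ∘ₗ antipodeOf k H h
          = (p ∘ₗ LinearMap.mulRight k b ∘ₗ antipodeOf k H h).smulRight a := by
        ext v
        simp
      rw [this, LinearMap.trace_smulRight]
      simp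
  have hc : antipodeContraction h p ∘ₗ TensorProduct.mk k _ _ c
      = (TensorProduct.rid k (H β')).toLinearMap ∘ₗ
          TensorProduct.map LinearMap.id p ∘ₗ LinearMap.mulRight k (comulOf k H h c) ∘ₗ
          (includeRight : H β →ₐ[k] H β' ⊗[k] H β).toLinearMap ∘ₗ antipodeOf k H h := by
    ext v
    simp [antipodeContraction_tmul]
  rw [hc, key, mul_antipodeOf_left, Algebra.algebraMap_eq_smul_one, map_smul]
  simp [mul_comm]

theorem isRightIntegral_traceIntegral (f : H (1 : π) →ₗ[k] k) :
    IsRightIntegral k H (traceIntegral f) := by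
  intro α β x
  rw [← sub_eq_zero, ← Module.forall_dual_apply_eq_zero_iff k]
  intro p
  rw [map_sub, sub_eq_zero]
  have hρ : α * β = α * β := rfl
  have hα : α * β * β⁻¹ = α := mul_inv_cancel_right α β
  have hβ : β⁻¹ * β = 1 := inv_mul_cancel β
  change p (TensorProduct.lid k (H β)
    (TensorProduct.map (traceIntegral f α) LinearMap.id (comulOf k H hρ x))) = _
  rw [apply_lid_map_traceIntegral]
  let B : H (α * β) ⊗[k] H β⁻¹ →ₗ[k] H α :=
    (TensorProduct.rid k (H α)).toLinearMap ∘ₗ TensorProduct.map (hitRLinear f α) p ∘ₗ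
      LinearMap.mulRight k (comulOf k H hρ x) ∘ₗ LinearMap.mul' k (H α ⊗[k] H β) ∘ₗ
      TensorProduct.map (includeRight : H β →ₐ[k] H α ⊗[k] H β).toLinearMap
        ((comulOf k H hρ).toLinearMap ∘ₗ antipodeOf k H (inv_mul_cancel (α * β))) ∘ₗ
      (TensorProduct.comm k (H (α * β)⁻¹) (H β)).toLinearMap ∘ₗ
      TensorProduct.map (antipodeOf k H (mul_inv_cancel (α * β))) (antipodeOf k H hβ)
  have hBA : (TensorProduct.rid k (H α)).toLinearMap ∘ₗ
        TensorProduct.map (hitRLinear f α) p ∘ₗ LinearMap.mulRight k (comulOf k H hρ x) ∘ₗ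
          (includeLeft : H α →ₐ[k] H α ⊗[k] H β).toLinearMap ∘ₗ sqAntipode k H α
      = B ∘ₗ (comulOf k H hα).toLinearMap := by
    ext y
    have := includeLeft_antipodeOf_antipodeOf (k := k) hρ (inv_mul_cancel (α * β))
      (mul_inv_cancel (α * β)) (inv_mul_cancel α) (mul_inv_cancel α) hβ hα y
    simp only [LinearMap.comp_apply, AlgHom.toLinearMap_apply, sqAntipode, this, B,
      LinearEquiv.coe_coe]
  have hAB : (comulOf k H hα).toLinearMap ∘ₗ B
      = TensorProduct.map LinearMap.id (antipodeContraction hβ p) ∘ₗ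
        (TensorProduct.assoc k _ _ _).toLinearMap ∘ₗ
        TensorProduct.map (TensorProduct.map (hitRLinear f (α * β)) LinearMap.id ∘ₗ
          (comulOf k H (mul_one (α * β))).toLinearMap ∘ₗ LinearMap.mulRight k x ∘ₗ
          sqAntipode k H (α * β)) LinearMap.id := by
    refine TensorProduct.ext' fun u v ↦ ?_
    have := comulOf_rid_map_hitRLinear f hρ hβ hα p (sqAntipode k H (α * β) u * x) v
    simp only [LinearMap.comp_apply, TensorProduct.map_tmul, AlgHom.toLinearMap_apply,
      LinearEquiv.coe_coe, LinearMap.mulRight_apply, LinearMap.id_apply, ← this, B]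
    simp [sqAntipode, mul_assoc]
  rw [hBA, LinearMap.trace_comp_comm', hAB,
    trace_map_id_comp_assoc_comp_map _ _ _ (trace_antipodeContraction hβ p)]
  have hε : (TensorProduct.rid k (H (α * β))).toLinearMap ∘ₗ
        TensorProduct.map LinearMap.id (p 1 • (counit k H).toLinearMap) ∘ₗ
        TensorProduct.map (hitRLinear f (α * β)) LinearMap.id ∘ₗ
          (comulOf k H (mul_one (α * β))).toLinearMap ∘ₗ LinearMap.mulRight k x ∘ₗ
          sqAntipode k H (α * β)
      = p 1 • (hitRLinear f (α * β) ∘ₗ LinearMap.mulRight k x ∘ₗ sqAntipode k H (α * β)) := by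
    ext y
    simp only [LinearMap.comp_apply, AlgHom.toLinearMap_apply, LinearEquiv.coe_coe,
      ← comulOf_hitRLinear, TensorProduct.map_smul_right, LinearMap.smul_apply, map_smul,
      rid_map_counit_comulOf]
  rw [hε, map_smul, ← traceIntegral_apply, map_smul, smul_eq_mul, smul_eq_mul, mul_comm]

end TraceIntegral

section IntegralPairing

open Algebra.TensorProduct (includeLeft includeRight)

variable {lam : ∀ α : π, H α →ₗ[k] k}

theorem IsRightIntegral.lid_map_comulOf (hlam : IsRightIntegral k H lam) {α β γ : π}
    (h : α * β = γ) (x : H γ) :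
    TensorProduct.lid k (H β) (TensorProduct.map (lam α) LinearMap.id (comulOf k H h x))
      = lam γ x • 1 := by
  subst h
  exact hlam α β x

theorem IsDistinguishedGrouplike.rid_map_comulOf {g : ∀ α : π, H α}
    (hg : IsDistinguishedGrouplike k H g) (hlam : IsRightIntegral k H lam) {α β γ : π}
    (h : α * β = γ) (x : H γ) :
    TensorProduct.rid k (H α) (TensorProduct.map LinearMap.id (lam β) (comulOf k H h x))
      = lam γ x • g α := by
  subst h
  exact hg.2 lam hlam α β x

variable {Λ : H (1 : π)}

/-- `Σ λ(S(x) Λ₁) Λ₂ = λ(Λ) x`. -/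
theorem IsRightIntegral.lid_map_antipodeOf (hlam : IsRightIntegral k H lam)
    (hΛ : ∀ x : H (1 : π), x * Λ = counit k H x • Λ) {α β : π} (h : α * β = 1) (h' : β * α = 1)
    (x : H α) :
    TensorProduct.lid k (H α)
        (TensorProduct.map (lam β ∘ₗ LinearMap.mulLeft k (antipodeOf k H h x)) LinearMap.id
          (comulOf k H h' Λ))
      = lam 1 Λ • x := by
  have h₁ : ∀ t : H β ⊗[k] H α, TensorProduct.lid k (H α)
        (TensorProduct.map (lam β ∘ₗ LinearMap.mulLeft k (antipodeOf k H h x)) LinearMap.id t)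
      = TensorProduct.lid k (H α) (TensorProduct.map (lam β) LinearMap.id
          ((includeLeft : H β →ₐ[k] H β ⊗[k] H α) (antipodeOf k H h x) * t)) := by
    intro t
    induction t with
    | zero => simp
    | add s t hs ht => simp only [map_add, mul_add, hs, ht]
    | tmul a b => simp
  have h₂ : ∀ t : H β ⊗[k] H α, TensorProduct.lid k (H α)
        (TensorProduct.map (lam β) LinearMap.id
          ((includeRight : H α →ₐ[k] H β ⊗[k] H α) x * t))
      = x * TensorProduct.lid k (H α) (TensorProduct.map (lam β) LinearMap.id t) := by
    intro t
    induction t with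
    | zero => simp
    | add s t hs ht => simp only [map_add, mul_add, hs, ht]
    | tmul a b => simp
  rw [h₁, includeLeft_antipodeOf_mul_comulOf hΛ, h₂, hlam.lid_map_comulOf]
  simp

/-- `Σ Λ₁ λ(S(x) Λ₂) = λ(Λ) S²(x) g`. -/
theorem IsDistinguishedGrouplike.rid_map_antipodeOf {g : ∀ α : π, H α}
    (hg : IsDistinguishedGrouplike k H g) (hlam : IsRightIntegral k H lam)
    (hΛ : ∀ x : H (1 : π), x * Λ = counit k H x • Λ) {α β : π} (h : α * β = 1) (h' : β * α = 1)
    (x : H α) :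
    TensorProduct.rid k (H α)
        (TensorProduct.map LinearMap.id (lam β ∘ₗ LinearMap.mulLeft k (antipodeOf k H h x))
          (comulOf k H h Λ))
      = lam 1 Λ • (antipodeOf k H h' (antipodeOf k H h x) * g α) := by
  have h₁ : ∀ t : H α ⊗[k] H β, TensorProduct.rid k (H α)
        (TensorProduct.map LinearMap.id (lam β ∘ₗ LinearMap.mulLeft k (antipodeOf k H h x)) t)
      = TensorProduct.rid k (H α) (TensorProduct.map LinearMap.id (lam β)
          ((includeRight : H β →ₐ[k] H α ⊗[k] H β) (antipodeOf k H h x) * t)) := by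
    intro t
    induction t with
    | zero => simp
    | add s t hs ht => simp only [map_add, mul_add, hs, ht]
    | tmul a b => simp
  have h₂ : ∀ (y : H α) (t : H α ⊗[k] H β), TensorProduct.rid k (H α)
        (TensorProduct.map LinearMap.id (lam β)
          ((includeLeft : H α →ₐ[k] H α ⊗[k] H β) y * t))
      = y * TensorProduct.rid k (H α) (TensorProduct.map LinearMap.id (lam β) t) := by
    intro y t
    induction t with
    | zero => simp
    | add s t hs ht => simp only [map_add, mul_add, hs, ht]
    | tmul a b => simp
  rw [h₁, ← includeLeft_antipodeOf_mul_comulOf hΛ h' h, h₂, hg.rid_map_comulOf hlam]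
  simp

variable (lam) in
/-- The map `x ↦ λ(S(x) ·)` from `H α` to the dual of `H β`. -/
def integralPairing {α β : π} (h : α * β = 1) : H α →ₗ[k] Module.Dual k (H β) :=
  (LinearMap.mul k (H β)).compr₂ (lam β) ∘ₗ antipodeOf k H h

theorem integralPairing_apply {α β : π} (h : α * β = 1) (x : H α) :
    integralPairing lam h x = lam β ∘ₗ LinearMap.mulLeft k (antipodeOf k H h x) := rfl

theorem IsRightIntegral.integralPairing_injective (hlam : IsRightIntegral k H lam)
    (hΛ : ∀ x : H (1 : π), x * Λ = counit k H x • Λ) (h0 : lam 1 Λ ≠ 0) {α β : π}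
    (h : α * β = 1) : Function.Injective (integralPairing lam h) := by
  intro x y hxy
  simp only [integralPairing_apply] at hxy
  have h' : β * α = 1 := mul_eq_one_comm.mp h
  have := hlam.lid_map_antipodeOf hΛ h h' x
  rw [hxy, hlam.lid_map_antipodeOf hΛ h h' y] at this
  exact (smul_right_injective _ h0 this).symm

theorem IsRightIntegral.integralPairing_surjective [∀ α, FiniteDimensional k (H α)]
    (hlam : IsRightIntegral k H lam)
    (hΛ : ∀ x : H (1 : π), x * Λ = counit k H x • Λ) (h0 : lam 1 Λ ≠ 0) {α β : π}
    (h : α * β = 1) : Function.Surjective (integralPairing lam h) := by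
  have h₁ := LinearMap.finrank_le_finrank_of_injective
    (hlam.integralPairing_injective hΛ h0 h)
  have h₂ := LinearMap.finrank_le_finrank_of_injective
    (hlam.integralPairing_injective hΛ h0 (mul_eq_one_comm.mp h))
  rw [Subspace.dual_finrank_eq] at h₁ h₂
  refine (LinearMap.injective_iff_surjective_of_finrank_eq_finrank ?_).mp
    (hlam.integralPairing_injective hΛ h0 h)
  rw [Subspace.dual_finrank_eq]
  exact le_antisymm h₁ h₂

end IntegralPairing

end HopfGCoalgebra

/-- Corollary 4.4: for a left integral `Λ` of `H₁` and the distinguished `π`-grouplike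
element `g`, one has `Λ_{(1,α)} ⊗ Λ_{(2,α⁻¹)} = S_{α⁻¹}(S_α(Λ_{(2,α)})) g_α ⊗ Λ_{(1,α⁻¹)}`. -/
theorem left_integral_comultiplication_symmetry (k : Type*) [Field k] {π : Type*}
    [Group π] (H : π → Type*) [∀ α, Ring (H α)] [∀ α, Algebra k (H α)]
    [HopfGCoalgebra k H] [∀ α, FiniteDimensional k (H α)]
    (Λ : H (1 : π)) (hΛ : ∀ x : H (1 : π), x * Λ = counit k H x • Λ)
    (g : ∀ α : π, H α) (hg : IsDistinguishedGrouplike k H g) :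
    ∀ α : π,
      comul k H α α⁻¹ ((gcast k H (mul_inv_cancel α).symm) Λ)
        = (TensorProduct.comm k (H α⁻¹) (H α))
            ((TensorProduct.map (LinearMap.id : H α⁻¹ →ₗ[k] H α⁻¹)
                ((LinearMap.mulRight k (g α)) ∘ₗ (gcast k H (inv_inv α)).toLinearMap ∘ₗ
                  antipode k H α⁻¹ ∘ₗ antipode k H α))
              (comul k H α⁻¹ α ((gcast k H (inv_mul_cancel α).symm) Λ))) := by
  intro α
  by_cases hΛ0 : Λ = 0
  · simp [hΛ0]
  obtain ⟨f, hf⟩ : ∃ f : Module.Dual k (H 1), f Λ ≠ 0 := by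
    by_contra! hf
    exact hΛ0 ((Module.forall_dual_apply_eq_zero_iff k Λ).mp hf)
  have hlam := isRightIntegral_traceIntegral (k := k) (H := H) f
  have h0 : traceIntegral f 1 Λ ≠ 0 := by rwa [traceIntegral_leftIntegral f hΛ]
  refine TensorProduct.ext_rid_map_dual fun q ↦ ?_
  have h := mul_inv_cancel α
  have h' := inv_mul_cancel α
  obtain ⟨x, rfl⟩ := hlam.integralPairing_surjective hΛ h0 h q
  have hR : ∀ (T : H α →ₗ[k] H α) (q : H α⁻¹ →ₗ[k] k) (t : H α⁻¹ ⊗[k] H α),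
      TensorProduct.rid k (H α) (TensorProduct.map LinearMap.id q
          (TensorProduct.comm k _ _ (TensorProduct.map LinearMap.id T t)))
        = T (TensorProduct.lid k (H α) (TensorProduct.map q LinearMap.id t)) := by
    intro T q t
    induction t with
    | zero => simp
    | add s t hs ht => simp only [map_add, hs, ht]
    | tmul a b => simp
  rw [hR]
  change TensorProduct.rid k (H α) (TensorProduct.map LinearMap.id _ (comulOf k H h Λ))
    = (LinearMap.mulRight k (g α) ∘ₗ antipodeOf k H h' ∘ₗ antipodeOf k H h)
      (TensorProduct.lid k (H α) (TensorProduct.map _ LinearMap.id (comulOf k H h' Λ)))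
  rw [integralPairing_apply, hg.rid_map_antipodeOf hlam hΛ h h', hlam.lid_map_antipodeOf hΛ h h']
  simp
end
end
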